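/- For every real number x ≥ e^{1800}, the interval (x, x + 2·x^{1/5}·log x] contains a squarefree integer. -/

import Mathlib

theorem spacing_card2 (V : Finset ℕ) (p D B : ℝ) (hB : 0 < B)
    (hV : ∀ u ∈ V, p ≤ (u:ℝ) ∧ (u:ℝ) ≤ p + D)
    (h3 : ∀ u ∈ V, ∀ v ∈ V, ∀ w ∈ V, u < v → v < w → B ≤ (w:ℝ) - u) :
    0 ≤ D → (V.card : ℝ) ≤ 2 * (1 + D / B) := by
  intro hD
  classical
  let f : ℕ → ℕ := fun u => ⌊((u:ℝ) - p) / B⌋₊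
  have hfib : ∀ u ∈ V, ∀ w ∈ V, f u = f w → (w:ℝ) - u < B := by
    intro u hu w hw h
    have hu0 : 0 ≤ ((u:ℝ) - p) / B := div_nonneg (by linarith [(hV u hu).1]) hB.le
    have hw0 : 0 ≤ ((w:ℝ) - p) / B := div_nonneg (by linarith [(hV w hw).1]) hB.le
    have h1 := Nat.floor_le hu0
    have h2 := Nat.lt_floor_add_one (((w:ℝ) - p) / B)
    have h4 : (⌊((u:ℝ) - p) / B⌋₊ : ℝ) = (⌊((w:ℝ) - p) / B⌋₊ : ℝ) := by exact_mod_cast h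
    have h5 : ((w:ℝ) - p) / B < ((u:ℝ) - p) / B + 1 := by linarith
    rw [div_add_one hB.ne', div_lt_div_iff_of_pos_right hB] at h5
    linarith
  have hmaps : Set.MapsTo f V (Finset.range (⌊D / B⌋₊ + 1)) := by
    intro u hu
    simp only [Finset.coe_range, Set.mem_Iio, f]
    apply Nat.lt_succ_of_le
    apply Nat.floor_le_floor
    apply div_le_div_of_nonneg_right _ hB.le
    linarith [(hV u hu).2]
  have hcard : V.card ≤ 2 * (Finset.range (⌊D / B⌋₊ + 1)).card := by
    apply Finset.card_le_mul_card_image_of_maps_to (f := f) (fun a ha => by simpa using hmaps ha)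
    intro b hb
    by_contra hcon
    push Not at hcon
    obtain ⟨u, v, w, hu, hv, hw, huv, huw, hvw⟩ := Finset.two_lt_card_iff.1 hcon
    simp only [Finset.mem_filter] at hu hv hw
    have e1 := hu.2; have e2 := hv.2; have e3 := hw.2
    have key : ∀ u v w : ℕ, u ∈ V → v ∈ V → w ∈ V → f u = b → f w = b → u < v → v < w → False := by
      intro u v w hu hv hw h1 h2 h4 h5
      have := h3 u hu v hv w hw h4 h5
      have := hfib u hu w hw (h1.trans h2.symm)
      linarith
    rcases lt_or_gt_of_ne huv with h1 | h1 <;> rcases lt_or_gt_of_ne huw with h2 | h2 <;>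
      rcases lt_or_gt_of_ne hvw with h4 | h4
    · exact key u v w hu.1 hv.1 hw.1 e1 e3 h1 h4
    · exact key u w v hu.1 hw.1 hv.1 e1 e2 h2 h4
    · omega
    · exact key w u v hw.1 hu.1 hv.1 e3 e2 h2 h1
    · exact key v u w hv.1 hu.1 hw.1 e2 e3 h1 h2
    · omega
    · exact key v w u hv.1 hw.1 hu.1 e2 e1 h4 h2
    · exact key w v u hw.1 hv.1 hu.1 e3 e1 h4 h1
  rw [Finset.card_range] at hcard
  have h7 : (V.card : ℝ) ≤ 2 * ((⌊D / B⌋₊ : ℝ) + 1) := by exact_mod_cast hcard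
  have := Nat.floor_le (div_nonneg hD hB.le)
  linarith

theorem spacing_card1 (V : Finset ℕ) (p D B : ℝ) (hB : 0 < B)
    (hV : ∀ u ∈ V, p ≤ (u:ℝ) ∧ (u:ℝ) ≤ p + D)
    (h3 : ∀ u ∈ V, ∀ v ∈ V, u < v → B ≤ (v:ℝ) - u) :
    0 ≤ D → (V.card : ℝ) ≤ 1 + D / B := by
  intro hD
  classical
  let f : ℕ → ℕ := fun u => ⌊((u:ℝ) - p) / B⌋₊
  have hfib : ∀ u ∈ V, ∀ w ∈ V, f u = f w → (w:ℝ) - u < B := by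
    intro u hu w hw h
    have hu0 : 0 ≤ ((u:ℝ) - p) / B := div_nonneg (by linarith [(hV u hu).1]) hB.le
    have h1 := Nat.floor_le hu0
    have h2 := Nat.lt_floor_add_one (((w:ℝ) - p) / B)
    have h4 : (⌊((u:ℝ) - p) / B⌋₊ : ℝ) = (⌊((w:ℝ) - p) / B⌋₊ : ℝ) := by exact_mod_cast h
    have h5 : ((w:ℝ) - p) / B < ((u:ℝ) - p) / B + 1 := by linarith
    rw [div_add_one hB.ne', div_lt_div_iff_of_pos_right hB] at h5
    linarith
  have hcard : V.card ≤ (Finset.range (⌊D / B⌋₊ + 1)).card := by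
    apply Finset.card_le_card_of_injOn f
    · intro u hu
      simp only [Finset.coe_range, Set.mem_Iio, f]
      apply Nat.lt_succ_of_le
      apply Nat.floor_le_floor
      apply div_le_div_of_nonneg_right _ hB.le
      linarith [(hV u hu).2]
    · intro u hu v hv h
      by_contra hne
      rcases lt_or_gt_of_ne hne with h1 | h1
      · have := h3 u hu v hv h1
        have := hfib u hu v hv h
        linarith
      · have := h3 v hv u hu h1
        have := hfib v hv u hu h.symm
        linarith
  rw [Finset.card_range] at hcard
  have h7 : (V.card : ℝ) ≤ ((⌊D / B⌋₊ : ℝ) + 1) := by exact_mod_cast hcard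
  have := Nat.floor_le (div_nonneg hD hB.le)
  linarith

/-- pairwise distance version -/
theorem spacing_card2' (V : Finset ℕ) (D B : ℝ) (hB : 0 < B) (hD : 0 ≤ D)
    (hV : ∀ u ∈ V, ∀ v ∈ V, u < v → (v:ℝ) - u ≤ D)
    (h3 : ∀ u ∈ V, ∀ v ∈ V, ∀ w ∈ V, u < v → v < w → B ≤ (w:ℝ) - u) :
    (V.card : ℝ) ≤ 2 * (1 + D / B) := by
  rcases V.eq_empty_or_nonempty with rfl | hne
  · simp; positivity
  · refine spacing_card2 V (V.min' hne) D B hB ?_ h3 hD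
    intro u hu
    have h1 := V.min'_le u hu
    refine ⟨by exact_mod_cast h1, ?_⟩
    rcases h1.lt_or_eq with h | h
    · have := hV _ (V.min'_mem hne) u hu h
      linarith
    · rw [← h]; linarith

set_option maxHeartbeats 2000000 in
theorem three_pt (x h T : ℝ) (a b p q r : ℝ) (ha : 1 ≤ a) (hb : 1 ≤ b)
    (hq : q = p + 2 * a) (hr : r = p + 2 * a + 2 * b)
    (hx : 0 < x) (hh : 0 < h) (hT : 0 < T) (hp : T ≤ p) (hr' : r ≤ 512/343 * T)
    (I : ℤ) (m1 m2 m3 : ℝ) (hI : (I:ℝ) = b * m1 - (a+b) * m2 + a * m3)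
    (h1 : x < m1 * p^2) (h1' : m1 * p^2 ≤ x + h)
    (h2 : x < m2 * q^2) (h2' : m2 * q^2 ≤ x + h)
    (h3 : x < m3 * r^2) (h3' : m3 * r^2 ≤ x + h)
    (H1 : 5 * h * T^2 ≤ 12 * x) (H2 : 15 * h^2 ≤ x) :
    9 * T^4 ≤ 120 * (a * b * (a+b)) * x := by
  have hp0 : 0 < p := by linarith
  have hq0 : 0 < q := by linarith
  have hr0 : 0 < r := by linarith
  obtain ⟨P, hP⟩ : ∃ P, P = 1/p := ⟨_, rfl⟩
  obtain ⟨Q, hQ⟩ : ∃ Q, Q = 1/q := ⟨_, rfl⟩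
  obtain ⟨R, hR⟩ : ∃ R, R = 1/r := ⟨_, rfl⟩
  obtain ⟨t, ht⟩ : ∃ t, t = 1/T := ⟨_, rfl⟩
  have ht0 : 0 < t := by rw [ht]; positivity
  have hP0 : 0 < P := by rw [hP]; positivity
  have hQ0 : 0 < Q := by rw [hQ]; positivity
  have hR0 : 0 < R := by rw [hR]; positivity
  have hPt : P ≤ t := by rw [hP, ht]; exact one_div_le_one_div_of_le hT hp
  have hQt : Q ≤ t := by rw [hQ, ht]; exact one_div_le_one_div_of_le hT (by linarith)
  have hRt : R ≤ t := by rw [hR, ht]; exact one_div_le_one_div_of_le hT (by linarith)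
  have lam : ∀ z, 0 < z → z ≤ 512/343 * T → 343/512 * t ≤ 1 / z := by
    intro z hz hz'
    rw [ht, le_div_iff₀ hz]
    have : 343/512 * (1/T) * z ≤ 343/512 * (1/T) * (512/343 * T) := by gcongr
    have e : 343/512 * (1/T) * (512/343 * T) = 1 := by field_simp
    linarith
  have hPl : 343/512 * t ≤ P := by rw [hP]; exact lam p hp0 (by linarith)
  have hQl : 343/512 * t ≤ Q := by rw [hQ]; exact lam q hq0 (by linarith)
  have hRl : 343/512 * t ≤ R := by rw [hR]; exact lam r hr0 (by linarith)
  have key : b * P^2 - (a+b) * Q^2 + a * R^2 = 4 * (a*b*(a+b)) * (P*Q*R*(P+Q+R)) := by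
    rw [hP, hQ, hR]
    rw [hq] at hq0 ⊢
    rw [hr] at hr0 ⊢
    field_simp
    ring
  have em : ∀ z Z m : ℝ, 0 < z → Z = 1/z → Z ≤ t → 0 < Z → x < m * z^2 → m * z^2 ≤ x + h →
      x * Z^2 < m ∧ m ≤ x * Z^2 + h * t^2 := by
    intro z Z m hz hZ hZt hZ0 hm hm'
    have e : m = m * z^2 * Z^2 := by rw [hZ]; field_simp
    have hZ2 : 0 < Z^2 := by positivity
    have hh : h * Z^2 ≤ h * t^2 := by gcongr
    constructor
    · rw [e]; exact mul_lt_mul_of_pos_right hm hZ2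
    · have := mul_le_mul_of_nonneg_right hm' hZ2.le
      rw [← e] at this
      linarith
  obtain ⟨l1, u1⟩ := em p P m1 hp0 hP hPt hP0 h1 h1'
  obtain ⟨l2, u2⟩ := em q Q m2 hq0 hQ hQt hQ0 h2 h2'
  obtain ⟨l3, u3⟩ := em r R m3 hr0 hR hRt hR0 h3 h3'
  have hab : 0 < a * b * (a+b) := by positivity
  have hT1 : T * t = 1 := by rw [ht]; field_simp
  by_contra hcon
  push Not at hcon
  -- a*b ≥ (a+b)/2
  have hab2 : (a+b)^2 ≤ 2 * (a * b * (a+b)) := by nlinarith [mul_nonneg (sub_nonneg.2 ha) (sub_nonneg.2 hb)]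
  have hsm : ((a+b) * h * t^2)^2 < 1/100 := by
    have e1 : (a+b)^2 * x * t^4 < 15/100 := by
      have h9 := mul_le_mul_of_nonneg_right hab2 hx.le
      have : (a+b)^2 * x < 15/100 * T^4 := by linarith
      calc (a+b)^2 * x * t^4 < 15/100 * T^4 * t^4 := by gcongr
        _ = 15/100 * (T*t)^4 := by ring
        _ = 15/100 := by rw [hT1]; norm_num
    have e2 : ((a+b) * h * t^2)^2 * 15 ≤ (a+b)^2 * x * t^4 := by
      have : (a+b)^2 * t^4 * (15 * h^2) ≤ (a+b)^2 * t^4 * x := by gcongr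
      linarith
    linarith
  have hsm2 : (a+b) * h * t^2 < 1/10 := by
    have : 0 ≤ (a+b) * h * t^2 := by positivity
    nlinarith
  have hmul := congrArg (fun z => x * z) key
  rcases le_or_gt I 0 with hI0 | hI0
  · have hI1 : (I:ℝ) ≤ 0 := by exact_mod_cast hI0
    have f1 := mul_lt_mul_of_pos_left l1 (by linarith : (0:ℝ) < b)
    have f3 := mul_lt_mul_of_pos_left l3 (by linarith : (0:ℝ) < a)
    have f2 := mul_le_mul_of_nonneg_left u2 (by linarith : (0:ℝ) ≤ a + b)
    have g : x * (4 * (a*b*(a+b)) * (P*Q*R*(P+Q+R))) < (a+b) * (h * t^2) := by linarith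
    have gl : x * (4 * (a*b*(a+b)) * ((343/512*t)*(343/512*t)*(343/512*t)*(343/512*t+343/512*t+343/512*t))) ≤
      x * (4 * (a*b*(a+b)) * (P*Q*R*(P+Q+R))) := by gcongr
    have g2 : (a+b) * (12 * (343/512)^4 * x * (a * b) * t^4) < (a+b) * (h * t^2) := by linarith
    have g3 := lt_of_mul_lt_mul_left g2 (by linarith)
    have g4 : 12 * (343/512)^4 * x * 1 * t^4 ≤ 12 * (343/512)^4 * x * (a * b) * t^4 := by
      gcongr
      nlinarith
    have g5 : (12 * (343/512)^4 * x) * t^4 * T^4 < h * t^2 * T^4 := by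
      apply mul_lt_mul_of_pos_right _ (by positivity)
      linarith
    have g6 : (12 * (343/512)^4 * x) * t^4 * T^4 = 12 * (343/512)^4 * x := by
      calc _ = (12 * (343/512)^4 * x) * (T*t)^4 := by ring
        _ = _ := by rw [hT1]; ring
    have g7 : h * t^2 * T^4 = h * T^2 := by
      calc _ = h * T^2 * (T*t)^2 := by ring
        _ = _ := by rw [hT1]; ring
    rw [g6, g7] at g5
    linarith
  · have hI1 : (1:ℝ) ≤ I := by exact_mod_cast hI0
    have f1 := mul_le_mul_of_nonneg_left u1 (by linarith : (0:ℝ) ≤ b)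
    have f3 := mul_le_mul_of_nonneg_left u3 (by linarith : (0:ℝ) ≤ a)
    have f2 := mul_lt_mul_of_pos_left l2 (by linarith : (0:ℝ) < a + b)
    have g : 1 ≤ x * (4 * (a*b*(a+b)) * (P*Q*R*(P+Q+R))) + (a+b) * h * t^2 := by linarith
    have gu : x * (4 * (a*b*(a+b)) * (P*Q*R*(P+Q+R))) ≤ x * (4 * (a*b*(a+b)) * (t*t*t*(t+t+t))) := by
      gcongr
    have g5 : (9/10) ≤ (12 * (a*b*(a+b)) * x) * t^4 := by linarith
    have g6 : 9/10 * T^4 ≤ 12 * (a*b*(a+b)) * x := by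
      have := mul_le_mul_of_nonneg_right g5 (by positivity : 0 ≤ T^4)
      have e : (12 * (a*b*(a+b)) * x) * t^4 * T^4 = 12 * (a*b*(a+b)) * x := by
        calc _ = (12 * (a*b*(a+b)) * x) * (T*t)^4 := by ring
          _ = _ := by rw [hT1]; ring
      linarith
    linarith


theorem lam_aux (T t z : ℝ) (hT : 0 < T) (ht : t = 1/T) (hz : 0 < z) (hz' : z ≤ 512/343 * T) :
    343/512 * t ≤ 1 / z := by
  rw [ht, le_div_iff₀ hz]
  have : 343/512 * (1/T) * z ≤ 343/512 * (1/T) * (512/343 * T) := by gcongr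
  have e : 343/512 * (1/T) * (512/343 * T) = 1 := by field_simp
  linarith

theorem em_aux (x h z Z m : ℝ) (hz : 0 < z) (hZ : Z = 1/z) (hm : x < m * z^2)
    (hm' : m * z^2 ≤ x + h) : x * Z^2 < m ∧ m ≤ x * Z^2 + h * Z^2 := by
  have hZ0 : 0 < Z := by rw [hZ]; positivity
  have e : m = m * z^2 * Z^2 := by rw [hZ]; field_simp
  have hZ2 : 0 < Z^2 := by positivity
  constructor
  · rw [e]; exact mul_lt_mul_of_pos_right hm hZ2
  · have := mul_le_mul_of_nonneg_right hm' hZ2.le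
    rw [← e] at this
    linarith

theorem em_aux' (x h z Z m t : ℝ) (hz : 0 < z) (hZ : Z = 1/z) (hh : 0 < h) (hZt : Z ≤ t)
    (hm : x < m * z^2)
    (hm' : m * z^2 ≤ x + h) : x * Z^2 < m ∧ m ≤ x * Z^2 + h * t^2 := by
  have hZ0 : 0 < Z := by rw [hZ]; positivity
  obtain ⟨h1, h2⟩ := em_aux x h z Z m hz hZ hm hm'
  have : h * Z^2 ≤ h * t^2 := by gcongr
  exact ⟨h1, by linarith⟩

set_option maxHeartbeats 2000000 in
theorem four_pt (x h T : ℝ) (a b p q r s : ℝ) (ha : 1 ≤ a) (hb : a < b)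
    (hq : q = p + 2 * a) (hr : r = p + 2 * b) (hs : s = p + 2 * a + 2 * b)
    (hx : 0 < x) (hh : 0 < h) (hT : 0 < T) (hp : T ≤ p) (hs' : s ≤ 512/343 * T)
    (I : ℤ) (m1 m2 m3 m4 : ℝ) (hI : (I:ℝ) = (b-a) * (m1-m4) + (a+b) * (m3 - m2))
    (h1 : x < m1 * p^2) (h1' : m1 * p^2 ≤ x + h)
    (h2 : x < m2 * q^2) (h2' : m2 * q^2 ≤ x + h)
    (h3 : x < m3 * r^2) (h3' : m3 * r^2 ≤ x + h)
    (h4 : x < m4 * s^2) (h4' : m4 * s^2 ≤ x + h)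
    (H0 : 9 * T^4 ≤ 120 * (a * (b-a) * b) * x)
    (H1 : h ≤ 16/100 * T) (H2 : 225 * h^3 ≤ x * T) :
    9 * T^5 ≤ 320 * (a * b^3) * x := by
  have hp0 : 0 < p := by linarith
  have hq0 : 0 < q := by linarith
  have hr0 : 0 < r := by linarith
  have hs0 : 0 < s := by linarith
  have hb0 : 0 < b := by linarith
  have ha0 : 0 < a := by linarith
  have hba : 0 < b - a := by linarith
  obtain ⟨P, hP⟩ : ∃ P, P = 1/p := ⟨_, rfl⟩
  obtain ⟨Q, hQ⟩ : ∃ Q, Q = 1/q := ⟨_, rfl⟩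
  obtain ⟨R, hR⟩ : ∃ R, R = 1/r := ⟨_, rfl⟩
  obtain ⟨S, hS⟩ : ∃ S, S = 1/s := ⟨_, rfl⟩
  obtain ⟨t, ht⟩ : ∃ t, t = 1/T := ⟨_, rfl⟩
  have ht0 : 0 < t := by rw [ht]; positivity
  have hP0 : 0 < P := by rw [hP]; positivity
  have hQ0 : 0 < Q := by rw [hQ]; positivity
  have hR0 : 0 < R := by rw [hR]; positivity
  have hS0 : 0 < S := by rw [hS]; positivity
  have hPt : P ≤ t := by rw [hP, ht]; exact one_div_le_one_div_of_le hT hp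
  have hQt : Q ≤ t := by rw [hQ, ht]; exact one_div_le_one_div_of_le hT (by linarith)
  have hRt : R ≤ t := by rw [hR, ht]; exact one_div_le_one_div_of_le hT (by linarith)
  have hSt : S ≤ t := by rw [hS, ht]; exact one_div_le_one_div_of_le hT (by linarith)
  have hPl : 343/512 * t ≤ P := by rw [hP]; exact lam_aux T t p hT ht hp0 (by linarith)
  have hQl : 343/512 * t ≤ Q := by rw [hQ]; exact lam_aux T t q hT ht hq0 (by linarith)
  have hRl : 343/512 * t ≤ R := by rw [hR]; exact lam_aux T t r hT ht hr0 (by linarith)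
  have hSl : 343/512 * t ≤ S := by rw [hS]; exact lam_aux T t s hT ht hs0 (by linarith)
  have key : (b-a) * (P^2 - S^2) + (a+b) * (R^2 - Q^2) =
      8 * (a*b*(b-a)*(b+a)) * (P*Q*R*S*(P+Q+R+S)) := by
    rw [hP, hQ, hR, hS]
    rw [hq] at hq0 ⊢
    rw [hr] at hr0 ⊢
    rw [hs] at hs0 ⊢
    field_simp
    ring
  obtain ⟨l1, u1⟩ := em_aux' x h p P m1 t hp0 hP hh hPt h1 h1'
  obtain ⟨l2, u2⟩ := em_aux' x h q Q m2 t hq0 hQ hh hQt h2 h2'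
  obtain ⟨l3, u3⟩ := em_aux' x h r R m3 t hr0 hR hh hRt h3 h3'
  obtain ⟨l4, u4⟩ := em_aux' x h s S m4 t hs0 hS hh hSt h4 h4'
  have hT1 : T * t = 1 := by rw [ht]; field_simp
  have hmul := congrArg (fun z => x * z) key
  clear key hP hQ hR hS ht hq hr hs h1 h1' h2 h2' h3 h3' h4 h4'
  have hc : 0 < a*b*(b-a)*(b+a) := by positivity
  rcases le_or_gt I 0 with hI0 | hI0
  · exfalso
    have hI1 : (I:ℝ) ≤ 0 := by exact_mod_cast hI0
    have f1 := mul_lt_mul_of_pos_left l1 hba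
    have f3 := mul_lt_mul_of_pos_left l3 (by linarith : (0:ℝ) < a + b)
    have f2 := mul_le_mul_of_nonneg_left u2 (by linarith : (0:ℝ) ≤ a + b)
    have f4 := mul_le_mul_of_nonneg_left u4 hba.le
    have g : x * (8 * (a*b*(b-a)*(b+a)) * (P*Q*R*S*(P+Q+R+S))) < 2 * b * (h * t^2) := by linarith
    have gl : x * (8 * (a*b*(b-a)*(b+a)) * ((343/512*t)*(343/512*t)*(343/512*t)*(343/512*t)*(343/512*t+343/512*t+343/512*t+343/512*t))) ≤
      x * (8 * (a*b*(b-a)*(b+a)) * (P*Q*R*S*(P+Q+R+S))) := by gcongr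
    have g2 : (2 * b) * (16 * (343/512)^5 * x * (a * (b-a) * (b+a)) * t^5) < (2 * b) * (h * t^2) := by
      linarith
    have g3 := lt_of_mul_lt_mul_left g2 (by linarith)
    have g5 : (16 * (343/512)^5 * x * (a * (b-a) * (b+a))) * t^5 * T^5 < h * t^2 * T^5 :=
      mul_lt_mul_of_pos_right g3 (by positivity)
    have g6 : (16 * (343/512)^5 * x * (a * (b-a) * (b+a))) * t^5 * T^5 = 16 * (343/512)^5 * x * (a * (b-a) * (b+a)) := by
      calc _ = (16 * (343/512)^5 * x * (a * (b-a) * (b+a))) * (T*t)^5 := by ring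
        _ = _ := by rw [hT1]; ring
    have g7 : h * t^2 * T^5 = h * T^3 := by
      calc _ = h * T^3 * (T*t)^2 := by ring
        _ = _ := by rw [hT1]; ring
    rw [g6, g7] at g5
    have g8 : (343/512:ℝ)^5 * 16 * x * (a * (b-a) * b) ≤ (343/512:ℝ)^5 * 16 * x * (a * (b-a) * (b+a)) := by
      gcongr; linarith
    have g9 : h * T^3 ≤ 16/100 * T * T^3 := by gcongr
    have g10 : 0 < T^4 := by positivity
    linarith
  · have hI1 : (1:ℝ) ≤ I := by exact_mod_cast hI0
    by_contra hcon
    push Not at hcon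
    have f1 := mul_le_mul_of_nonneg_left u1 hba.le
    have f3 := mul_le_mul_of_nonneg_left u3 (by linarith : (0:ℝ) ≤ a + b)
    have f2 := mul_lt_mul_of_pos_left l2 (by linarith : (0:ℝ) < a + b)
    have f4 := mul_lt_mul_of_pos_left l4 hba
    have g : 1 ≤ x * (8 * (a*b*(b-a)*(b+a)) * (P*Q*R*S*(P+Q+R+S))) + 2 * (b * h * t^2) := by linarith
    have gu : x * (8 * (a*b*(b-a)*(b+a)) * (P*Q*R*S*(P+Q+R+S))) ≤
        x * (8 * (a*b*(b-a)*(b+a)) * (t*t*t*t*(t+t+t+t))) := by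
      gcongr
    have hsm : (b * h * t^2)^3 < (1/20)^3 := by
      have e0 : 320 * b^3 * x ≤ 320 * (a * b^3) * x := by
        have : 0 < b^3 * x := by positivity
        nlinarith
      have e1 : b^3 * x < 9/320 * T^5 := by linarith
      have e3 : b^3 * t^6 * (225 * h^3) ≤ b^3 * t^6 * (x * T) := by gcongr
      have e4 : b^3 * x * (t^6 * T) < 9/320 * T^5 * (t^6 * T) := by gcongr
      have e5 : 9/320 * T^5 * (t^6 * T) = 9/320 := by
        calc _ = 9/320 * (T*t)^6 := by ring
          _ = _ := by rw [hT1]; ring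
      rw [e5] at e4
      have e6 : (b*h*t^2)^3 = b^3 * t^6 * h^3 := by ring
      linarith
    have hsm2 : b * h * t^2 < 1/20 := lt_of_pow_lt_pow_left₀ 3 (by norm_num) hsm
    have g5 : 9/10 ≤ (32 * (a*b*(b-a)*(b+a)) * x) * t^5 := by linarith
    have g6 : 9/10 * T^5 ≤ 32 * (a*b*(b-a)*(b+a)) * x := by
      have := mul_le_mul_of_nonneg_right g5 (by positivity : 0 ≤ T^5)
      have e : (32 * (a*b*(b-a)*(b+a)) * x) * t^5 * T^5 = 32 * (a*b*(b-a)*(b+a)) * x := by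
        calc _ = (32 * (a*b*(b-a)*(b+a)) * x) * (T*t)^5 := by ring
          _ = _ := by rw [hT1]; ring
      linarith
    have g7 : 0 ≤ a * b * a^2 * x := by positivity
    linarith

theorem pair_pt (x h T : ℝ) (a p q : ℝ) (ha : 1 ≤ a) (hq : q = p + 2 * a)
    (hx : 0 < x) (hh : 0 < h) (hT : 0 < T) (hp : T ≤ p) (hap : a ≤ p)
    (m1 m2 : ℝ)
    (h1 : x < m1 * p^2) (h1' : m1 * p^2 ≤ x + h)
    (h2 : x < m2 * q^2) (h2' : m2 * q^2 ≤ x + h) :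
    |((p + 3 * a) * m2 - (p - a) * m1) - 4 * a^3 * x * ((1/p)^2 * (1/q)^2)| ≤ h / T := by
  have hp0 : 0 < p := by linarith
  have hq0 : 0 < q := by linarith
  obtain ⟨l1, u1⟩ := em_aux x h p (1/p) m1 hp0 rfl h1 h1'
  obtain ⟨l2, u2⟩ := em_aux x h q (1/q) m2 hq0 rfl h2 h2'
  have key : (p+3*a) * (1/q)^2 - (p-a) * (1/p)^2 = 4 * a^3 * ((1/p)^2 * (1/q)^2) := by
    rw [hq] at hq0 ⊢
    field_simp
    ring
  have hmul : x * ((p+3*a) * (1/q)^2 - (p-a) * (1/p)^2) = x * (4 * a^3 * ((1/p)^2 * (1/q)^2)) := by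
    rw [key]
  have e1 : (p + 3*a) * (1/q)^2 ≤ 1/p := by
    rw [one_div_pow, mul_one_div, div_le_div_iff₀ (by positivity) hp0, hq]
    nlinarith [sq_nonneg a, mul_pos hp0 (by linarith : 0 < a)]
  have e2 : (p - a) * (1/p)^2 ≤ 1/p := by
    rw [one_div_pow, mul_one_div, div_le_div_iff₀ (by positivity) hp0]
    nlinarith [mul_pos hp0 (by linarith : 0 < a)]
  have e3 : h * (1/p) ≤ h / T := by
    rw [mul_one_div]
    exact div_le_div_of_nonneg_left hh.le hT hp
  have f2 := mul_le_mul_of_nonneg_left u2 (by linarith : 0 ≤ p + 3*a)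
  have f2' := mul_le_mul_of_nonneg_left l2.le (by linarith : 0 ≤ p + 3*a)
  have f1 := mul_le_mul_of_nonneg_left u1 (by linarith : 0 ≤ p - a)
  have f1' := mul_le_mul_of_nonneg_left l1.le (by linarith : 0 ≤ p - a)
  have k1 := mul_le_mul_of_nonneg_left e1 hh.le
  have k2 := mul_le_mul_of_nonneg_left e2 hh.le
  rw [abs_le]
  constructor <;> linarith

theorem F_bounds (T p q : ℝ) (hT : 0 < T) (hp : T ≤ p) (hpq : p ≤ q) (hq : q ≤ 512/343*T) :
    (343/512)^4 / T^4 ≤ (1/p)^2 * (1/q)^2 ∧ (1/p)^2 * (1/q)^2 ≤ 1/T^4 := by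
  have hp0 : 0 < p := by linarith
  have hq0 : 0 < q := by linarith
  have l1 := lam_aux T (1/T) p hT rfl hp0 (by linarith)
  have l2 := lam_aux T (1/T) q hT rfl hq0 (by linarith)
  have u1 : 1/p ≤ 1/T := one_div_le_one_div_of_le hT hp
  have u2 : 1/q ≤ 1/T := one_div_le_one_div_of_le hT (by linarith)
  constructor
  · calc (343/512)^4 / T^4 = (343/512 * (1/T))^2 * (343/512 * (1/T))^2 := by field_simp
      _ ≤ _ := by gcongr
  · calc (1/p)^2 * (1/q)^2 ≤ (1/T)^2 * (1/T)^2 := by gcongr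
      _ = _ := by field_simp

theorem F_diff (T a b p q r s : ℝ) (hT : 0 < T) (hp : T ≤ p) (ha : 0 ≤ a) (hb : 0 ≤ b)
    (hq : q = p + 2 * a) (hr : r = p + 2 * b) (hs : s = p + 2 * a + 2 * b) (hs' : s ≤ 512/343*T) :
    8 * b * (343/512)^5 / T^5 ≤ (1/p)^2 * (1/q)^2 - (1/r)^2 * (1/s)^2 := by
  have hp0 : 0 < p := by linarith
  have hq0 : 0 < q := by linarith
  have hr0 : 0 < r := by linarith
  have hs0 : 0 < s := by linarith
  have l1 := lam_aux T (1/T) p hT rfl hp0 (by linarith)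
  have l2 := lam_aux T (1/T) q hT rfl hq0 (by linarith)
  have l3 := lam_aux T (1/T) r hT rfl hr0 (by linarith)
  have l4 := lam_aux T (1/T) s hT rfl hs0 (by linarith)
  have key : (1/p)^2 * (1/q)^2 - (1/r)^2 * (1/s)^2 =
     2 * b * ((1/q)*(1/r)*(1/s) + (1/p)*(1/q)*(1/r)) * ((1/p)*(1/q) + (1/r)*(1/s)) := by
    rw [hq] at hq0 ⊢
    rw [hr] at hr0 ⊢
    rw [hs] at hs0 ⊢
    field_simp
    ring
  rw [key]
  have : 8 * b * (343/512)^5 / T^5 = 2 * b * ((343/512 * (1/T))*(343/512 * (1/T))*(343/512 * (1/T)) + (343/512 * (1/T))*(343/512 * (1/T))*(343/512 * (1/T))) * ((343/512 * (1/T))*(343/512 * (1/T)) + (343/512 * (1/T))*(343/512 * (1/T))) := by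
    field_simp; ring
  rw [this]
  gcongr


def Good (x h T : ℝ) (S : Finset ℕ) (m : ℕ → ℤ) : Prop :=
  ∀ d ∈ S, T ≤ (d:ℝ) ∧ (d:ℝ) ≤ 512/343 * T ∧ Odd d ∧ x < (m d : ℝ) * (d:ℝ)^2 ∧
    (m d : ℝ) * (d:ℝ)^2 ≤ x + h

theorem G3 {x h T : ℝ} {S : Finset ℕ} {m : ℕ → ℤ} (hG : Good x h T S m)
    (hx : 0 < x) (hh : 0 < h) (hT : 0 < T)
    (H1 : 5 * h * T^2 ≤ 12 * x) (H2 : 15 * h^2 ≤ x)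
    {u a e : ℕ} (ha : 1 ≤ a) (hae : a < e) (h1 : u ∈ S) (h2 : u + 2 * a ∈ S) (h3 : u + 2 * e ∈ S) :
    9 * T^4 ≤ 120 * ((a:ℝ) * (e - a) * e) * x := by
  obtain ⟨g1, -, -, g2, g3⟩ := hG _ h1
  obtain ⟨-, -, -, k2, k3⟩ := hG _ h2
  obtain ⟨-, l1, -, l2, l3⟩ := hG _ h3
  push_cast at *
  have hae' : (a:ℝ) + 1 ≤ e := by exact_mod_cast hae
  have ha' : (1:ℝ) ≤ a := by exact_mod_cast ha
  have := three_pt x h T a (e - a) u (u + 2 * a) (u + 2 * e) ha' (by linarith) rfl (by ring)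
    hx hh hT g1 l1 (((e:ℤ) - a) * m u - e * m (u + 2 * a) + a * m (u + 2 * e)) (m u) (m (u+2*a))
    (m (u+2*e)) (by push_cast; ring) g2 g3 k2 k3 l2 l3 H1 H2
  calc 9 * T^4 ≤ _ := this
    _ = _ := by ring

theorem G4 {x h T : ℝ} {S : Finset ℕ} {m : ℕ → ℤ} (hG : Good x h T S m)
    (hx : 0 < x) (hh : 0 < h) (hT : 0 < T)
    (H1 : 5 * h * T^2 ≤ 12 * x) (H2 : 15 * h^2 ≤ x)
    (H3 : h ≤ 72/1000 * T) (H4 : 225 * h^3 ≤ x * T)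
    {u a b : ℕ} (ha : 1 ≤ a) (hab : a < b) (h1 : u ∈ S) (h2 : u + 2 * a ∈ S) (h3 : u + 2 * b ∈ S)
    (h4 : u + 2 * b + 2 * a ∈ S) :
    9 * T^5 ≤ 320 * ((a:ℝ) * b^3) * x := by
  have H0 := G3 hG hx hh hT H1 H2 ha hab h1 h2 h3
  obtain ⟨g1, -, -, g2, g3⟩ := hG _ h1
  obtain ⟨-, -, -, k2, k3⟩ := hG _ h2
  obtain ⟨-, -, -, l2, l3⟩ := hG _ h3
  obtain ⟨-, n1, -, n2, n3⟩ := hG _ h4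
  push_cast at *
  have hab' : (a:ℝ) < b := by exact_mod_cast hab
  have ha' : (1:ℝ) ≤ a := by exact_mod_cast ha
  exact four_pt x h T a b u (u + 2 * a) (u + 2 * b) (u + 2 * b + 2 * a) ha' hab' rfl rfl (by ring)
    hx hh hT g1 n1 (((b:ℤ) - a) * (m u - m (u+2*b+2*a)) + (a + b) * (m (u + 2 * b) - m (u + 2 * a)))
    (m u) (m (u+2*a)) (m (u+2*b)) (m (u+2*b+2*a)) (by push_cast; ring) g2 g3 k2 k3 l2 l3 n2 n3 H0
    (by linarith) H4

def NN (m : ℕ → ℤ) (u a : ℕ) : ℤ := ((u:ℤ) + 3 * a) * m (u + 2 * a) - ((u:ℤ) - a) * m u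

noncomputable def FF (x : ℝ) (u a : ℕ) : ℝ :=
  4 * (a:ℝ)^3 * x * ((1/(u:ℝ))^2 * (1/((u:ℝ) + 2 * a))^2)

theorem GN {x h T : ℝ} {S : Finset ℕ} {m : ℕ → ℤ} (hG : Good x h T S m)
    (hx : 0 < x) (hh : 0 < h) (hT : 0 < T)
    {u a : ℕ} (ha : 1 ≤ a) (h1 : u ∈ S) (h2 : u + 2 * a ∈ S) :
    |(NN m u a : ℝ) - FF x u a| ≤ h / T := by
  obtain ⟨g1, -, -, g2, g3⟩ := hG _ h1
  obtain ⟨-, k1, -, k2, k3⟩ := hG _ h2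
  push_cast at *
  have ha' : (1:ℝ) ≤ a := by exact_mod_cast ha
  have := pair_pt x h T a u (u + 2 * a) ha' rfl hx hh hT g1 (by linarith) (m u) (m (u+2*a))
    g2 g3 k2 k3
  simpa [NN, FF] using this

theorem GF {x h T : ℝ} {S : Finset ℕ} {m : ℕ → ℤ} (hG : Good x h T S m)
    (hx : 0 < x) (hT : 0 < T)
    {u a : ℕ} (h1 : u ∈ S) (h2 : u + 2 * a ∈ S) :
    4 * (a:ℝ)^3 * x * ((343/512)^4 / T^4) ≤ FF x u a ∧ FF x u a ≤ 4 * (a:ℝ)^3 * x * (1/T^4) := by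
  obtain ⟨g1, -, -, -, -⟩ := hG _ h1
  obtain ⟨-, k1, -, -, -⟩ := hG _ h2
  push_cast at *
  obtain ⟨e1, e2⟩ := F_bounds T u (u + 2 * a) hT g1 (by linarith [(Nat.cast_nonneg a : (0:ℝ) ≤ a)]) k1
  unfold FF
  constructor <;> gcongr

theorem GD {x h T : ℝ} {S : Finset ℕ} {m : ℕ → ℤ} (hG : Good x h T S m)
    (hx : 0 < x) (hT : 0 < T)
    {u a b : ℕ} (h1 : u ∈ S) (h4 : u + 2 * b + 2 * a ∈ S) :
    4 * (a:ℝ)^3 * x * (8 * b * (343/512)^5 / T^5) ≤ FF x u a - FF x (u + 2 * b) a := by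
  obtain ⟨g1, -, -, -, -⟩ := hG _ h1
  obtain ⟨-, k1, -, -, -⟩ := hG _ h4
  push_cast at *
  have := F_diff T a b u (u + 2 * a) (u + 2 * b) (u + 2 * b + 2 * a) hT g1 (by positivity) (by positivity)
    rfl rfl (by ring) k1
  unfold FF
  push_cast
  rw [← mul_sub]
  gcongr

noncomputable def nxt (S : Finset ℕ) (u : ℕ) : ℕ :=
  if h : (S.filter (fun v => u < v)).Nonempty then (S.filter (fun v => u < v)).min' h else u

theorem nxt_mem {S : Finset ℕ} {u : ℕ} (h : u < nxt S u) : nxt S u ∈ S := by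
  unfold nxt at h ⊢
  split_ifs at h ⊢ with h1
  · have := Finset.min'_mem _ h1
    exact (Finset.mem_filter.1 this).1
  · omega

theorem nxt_le {S : Finset ℕ} {u v : ℕ} (hv : v ∈ S) (huv : u < v) : nxt S u ≤ v := by
  unfold nxt
  have hm : v ∈ S.filter (fun v => u < v) := Finset.mem_filter.2 ⟨hv, huv⟩
  rw [dif_pos ⟨v, hm⟩]
  exact Finset.min'_le _ _ hm

theorem lt_nxt {S : Finset ℕ} {u v : ℕ} (hv : v ∈ S) (huv : u < v) : u < nxt S u := by
  unfold nxt
  have hm : v ∈ S.filter (fun v => u < v) := Finset.mem_filter.2 ⟨hv, huv⟩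
  rw [dif_pos ⟨v, hm⟩]
  exact (Finset.mem_filter.1 (Finset.min'_mem _ ⟨v, hm⟩)).2

noncomputable def hg (S : Finset ℕ) (u : ℕ) : ℕ := (nxt S u - u) / 2

noncomputable def S1 (S : Finset ℕ) : Finset ℕ := S.filter (fun u => u < nxt S u)

theorem card_S1 (S : Finset ℕ) : S.card ≤ (S1 S).card + 1 := by
  have : (S.filter (fun u => ¬ u < nxt S u)).card ≤ 1 := by
    rw [Finset.card_le_one]
    intro a ha b hb
    rw [Finset.mem_filter] at ha hb
    by_contra hne
    rcases lt_or_gt_of_ne hne with h | h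
    · exact ha.2 (lt_nxt hb.1 h)
    · exact hb.2 (lt_nxt ha.1 h)
  have h2 := Finset.card_filter_add_card_filter_not (s := S) (fun u => u < nxt S u)
  unfold S1
  omega

theorem S1_prop {x h T : ℝ} {S : Finset ℕ} {m : ℕ → ℤ} (hG : Good x h T S m) {u : ℕ}
    (hu : u ∈ S1 S) : u ∈ S ∧ 1 ≤ hg S u ∧ nxt S u = u + 2 * hg S u ∧ u + 2 * hg S u ∈ S := by
  obtain ⟨h1, h2⟩ := Finset.mem_filter.1 hu
  have h3 := nxt_mem h2
  have o1 := (hG _ h1).2.2.1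
  have o2 := (hG _ h3).2.2.1
  have e : nxt S u = u + 2 * hg S u := by
    unfold hg
    obtain ⟨i, hi⟩ := o1
    obtain ⟨j, hj⟩ := o2
    omega
  refine ⟨h1, by omega, e, e ▸ h3⟩

theorem odd_diff {x h T : ℝ} {S : Finset ℕ} {m : ℕ → ℤ} (hG : Good x h T S m) {u v : ℕ}
    (hu : u ∈ S) (hv : v ∈ S) (huv : u < v) : ∃ b, 1 ≤ b ∧ v = u + 2 * b := by
  obtain ⟨i, hi⟩ := (hG _ hu).2.2.1
  obtain ⟨j, hj⟩ := (hG _ hv).2.2.1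
  exact ⟨j - i, by omega, by omega⟩

/-- fiber with fixed gap `a`; window `D`. -/
theorem fiber_card {x h T : ℝ} {S : Finset ℕ} {m : ℕ → ℤ} (hG : Good x h T S m)
    (hx : 0 < x) (hh : 0 < h) (hT : 0 < T)
    (H1 : 5 * h * T^2 ≤ 12 * x) (H2 : 15 * h^2 ≤ x)
    (H3 : h ≤ 72/1000 * T) (H4 : 225 * h^3 ≤ x * T)
    (V : Finset ℕ) (a n : ℕ) (B D : ℝ) (hB : 0 < B) (hD : 0 ≤ D) (han : a ≤ n)
    (hBn : 320 * ((n:ℝ) * B^3) * x ≤ 9 * T^5)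
    (hV : ∀ u ∈ V, u ∈ S1 S ∧ hg S u = a)
    (hVD : ∀ u ∈ V, ∀ v ∈ V, u < v → (v:ℝ) - u ≤ 2 * D) :
    (V.card : ℝ) ≤ 2 * (1 + D / B) := by
  have := spacing_card2' V (2 * D) (2 * B) (by positivity) (by positivity) hVD ?_
  · rwa [mul_div_mul_left _ _ (two_ne_zero)] at this
  intro u hu v hv w hw huv hvw
  obtain ⟨u1, ua⟩ := hV u hu
  obtain ⟨v1, va⟩ := hV v hv
  obtain ⟨w1, wa⟩ := hV w hw
  obtain ⟨pu, pu1, pu2, pu3⟩ := S1_prop hG u1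
  obtain ⟨pv, pv1, pv2, pv3⟩ := S1_prop hG v1
  obtain ⟨pw, pw1, pw2, pw3⟩ := S1_prop hG w1
  rw [ua] at pu1 pu2 pu3
  rw [va] at pv1 pv2 pv3
  rw [wa] at pw1 pw2 pw3
  have e1 := nxt_le pv huv
  have e2 := nxt_le pw hvw
  obtain ⟨b, hb1, hb⟩ := odd_diff hG pu pw (huv.trans hvw)
  have hab : a < b := by omega
  rw [hb] at pw pw3
  have k := G4 hG hx hh hT H1 H2 H3 H4 pu1 hab pu pu3 pw pw3
  have hBb : B ≤ b := by
    by_contra hcon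
    push Not at hcon
    have ha0 : (0:ℝ) < a := by exact_mod_cast pu1
    have k2 : 320 * ((a:ℝ) * b^3) * x < 320 * ((n:ℝ) * B^3) * x := by
      have i1 : (b:ℝ)^3 < B^3 := by gcongr
      have i2 : (a:ℝ) ≤ n := by exact_mod_cast han
      have : (a:ℝ) * b^3 < n * B^3 := by
        calc (a:ℝ) * b^3 < a * B^3 := by gcongr
          _ ≤ n * B^3 := by gcongr
      gcongr
    linarith
  rw [hb]
  push_cast
  linarith

theorem long_card {x h T : ℝ} {S : Finset ℕ} {m : ℕ → ℤ} (hG : Good x h T S m) (hT : 0 < T)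
    (n : ℕ) : (((S1 S).filter (fun u => n < hg S u)).card : ℝ) ≤ 1 + (169/343 * T) / (2 * (n + 1)) := by
  refine spacing_card1 _ T (169/343 * T) (2 * (n+1)) (by positivity) ?_ ?_ (by positivity)
  · intro u hu
    obtain ⟨h1, h2, -⟩ := hG u (S1_prop hG (Finset.mem_filter.1 hu).1).1
    exact ⟨h1, by linarith⟩
  · intro u hu v hv huv
    obtain ⟨u1, u2⟩ := Finset.mem_filter.1 hu
    obtain ⟨v1, v2⟩ := Finset.mem_filter.1 hv
    obtain ⟨pu, pu1, pu2, pu3⟩ := S1_prop hG u1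
    obtain ⟨pv, -⟩ := S1_prop hG v1
    have e1 := nxt_le pv huv
    have : u + 2 * (n + 1) ≤ v := by omega
    have : (u:ℝ) + 2 * (n + 1) ≤ v := by exact_mod_cast this
    linarith

noncomputable def Z0 (S : Finset ℕ) (m : ℕ → ℤ) : Finset ℕ :=
  (S1 S).filter (fun u => NN m u (hg S u) = 0)

theorem Z0_gap {x h T : ℝ} {S : Finset ℕ} {m : ℕ → ℤ} (hG : Good x h T S m)
    (hx : 0 < x) (hh : 0 < h) (hT : 0 < T) {u : ℕ} (hu : u ∈ Z0 S m) :
    4 * (hg S u : ℝ)^3 * x * (343/512)^4 ≤ h * T^3 := by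
  obtain ⟨u1, u2⟩ := Finset.mem_filter.1 hu
  obtain ⟨pu, pu1, pu2, pu3⟩ := S1_prop hG u1
  have k := GN hG hx hh hT pu1 pu pu3
  have k2 := (GF hG hx hT pu pu3).1
  rw [u2] at k
  have k3 := (abs_le.1 k).1
  push_cast at k3
  have k4 : 4 * (hg S u : ℝ)^3 * x * ((343/512)^4 / T^4) ≤ h / T := by linarith
  have k5 := mul_le_mul_of_nonneg_right k4 (by positivity : 0 ≤ T^4)
  have e1 : 4 * (hg S u : ℝ)^3 * x * ((343/512)^4 / T^4) * T^4 = 4 * (hg S u : ℝ)^3 * x * (343/512)^4 := by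
    field_simp
  have e2 : h / T * T^4 = h * T^3 := by field_simp
  linarith

theorem Z0_card4 {x h T : ℝ} {S : Finset ℕ} {m : ℕ → ℤ} (hG : Good x h T S m)
    (hx : 0 < x) (hh : 0 < h) (hT : 0 < T)
    (H1 : 5 * h * T^2 ≤ 12 * x) (H2 : 15 * h^2 ≤ x)
    (H3 : h ≤ 72/1000 * T) (H4 : 225 * h^3 ≤ x * T)
    (a1 B : ℝ) (ha1 : 0 < a1) (hB : 0 < B) (hBn : 320 * (a1 * B^3) * x ≤ 9 * T^5)
    (ha : h * T^3 ≤ 4 * a1^3 * x * (343/512)^4) :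
    ((Z0 S m).card : ℝ) ≤ a1 * (2 * (1 + (169/686 * T) / B)) := by
  have hle : ∀ u ∈ Z0 S m, (hg S u : ℝ) ≤ a1 := by
    intro u hu
    have k := Z0_gap hG hx hh hT hu
    by_contra hcon
    push Not at hcon
    have : 4 * a1^3 * x * (343/512)^4 < 4 * (hg S u : ℝ)^3 * x * (343/512)^4 := by gcongr
    linarith
  have hn : (⌊a1⌋₊ : ℝ) ≤ a1 := Nat.floor_le ha1.le
  have hmaps : ∀ u ∈ Z0 S m, hg S u ∈ Finset.Icc 1 ⌊a1⌋₊ := by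
    intro u hu
    rw [Finset.mem_Icc]
    exact ⟨(S1_prop hG (Finset.mem_filter.1 hu).1).2.1, Nat.le_floor (hle u hu)⟩
  rw [Finset.card_eq_sum_card_fiberwise hmaps]
  push_cast
  calc ∑ a ∈ Finset.Icc 1 ⌊a1⌋₊, (((Z0 S m).filter (fun u => hg S u = a)).card : ℝ)
      ≤ ∑ a ∈ Finset.Icc 1 ⌊a1⌋₊, (2 * (1 + (169/686 * T) / B)) := by
        apply Finset.sum_le_sum
        intro a ha
        rw [Finset.mem_Icc] at ha
        refine fiber_card hG hx hh hT H1 H2 H3 H4 _ a ⌊a1⌋₊ B (169/686 * T) hB (by positivity) ha.2 ?_ ?_ ?_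
        · refine le_trans ?_ hBn
          gcongr
        · intro u hu
          obtain ⟨u1, u2⟩ := Finset.mem_filter.1 hu
          exact ⟨(Finset.mem_filter.1 u1).1, u2⟩
        · intro u hu v hv huv
          have i1 := hG u (S1_prop hG (Finset.mem_filter.1 (Finset.mem_filter.1 hu).1).1).1
          have i2 := hG v (S1_prop hG (Finset.mem_filter.1 (Finset.mem_filter.1 hv).1).1).1
          linarith [i1.1, i2.2.1]
    _ = ⌊a1⌋₊ * (2 * (1 + (169/686 * T) / B)) := by
        rw [Finset.sum_const, Nat.card_Icc]; simp
    _ ≤ _ := by gcongr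

theorem Z0_card3 {x h T : ℝ} {S : Finset ℕ} {m : ℕ → ℤ} (hG : Good x h T S m)
    (hx : 0 < x) (hh : 0 < h) (hT : 0 < T)
    (H1 : 5 * h * T^2 ≤ 12 * x) (H2 : 15 * h^2 ≤ x)
    (H3 : 100 * h ≤ T)
    (a1 c : ℝ) (ha1 : 0 < a1) (hc : 0 < c) (hcn : 120 * (a1 * c^2) * x ≤ 9 * T^4)
    (ha : h * T^3 ≤ 4 * a1^3 * x * (343/512)^4) :
    ((Z0 S m).card : ℝ) ≤ 1 + (169/343 * T) / (2 * c) := by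
  have hle : ∀ u ∈ Z0 S m, (hg S u : ℝ) ≤ a1 := by
    intro u hu
    have k := Z0_gap hG hx hh hT hu
    by_contra hcon
    push Not at hcon
    have : 4 * a1^3 * x * (343/512)^4 < 4 * (hg S u : ℝ)^3 * x * (343/512)^4 := by gcongr
    linarith
  refine spacing_card1 _ T (169/343 * T) (2 * c) (by positivity) ?_ ?_ (by positivity)
  · intro u hu
    obtain ⟨h1, h2, -⟩ := hG u (S1_prop hG (Finset.mem_filter.1 hu).1).1
    exact ⟨h1, by linarith⟩
  · intro u hu v hv huv
    obtain ⟨u1, u2⟩ := Finset.mem_filter.1 hu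
    obtain ⟨v1, v2⟩ := Finset.mem_filter.1 hv
    obtain ⟨pu, pu1, pu2, pu3⟩ := S1_prop hG u1
    obtain ⟨pv, pv1, pv2, pv3⟩ := S1_prop hG v1
    have e1 := nxt_le pv huv
    obtain ⟨e, he1, he⟩ := odd_diff hG pu pv huv
    rw [pu2, he] at e1
    have hae : hg S u ≤ e := by omega
    rcases hae.lt_or_eq with hlt | heq
    · rw [he] at pv
      have k := G3 hG hx hh hT H1 H2 pu1 hlt pu pu3 pv
      have hce : c ≤ e := by
        by_contra hcon
        push Not at hcon
        have i0 := hle u hu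
        have i3 : (hg S u : ℝ) < e := by exact_mod_cast hlt
        have i4 : (0:ℝ) ≤ hg S u := Nat.cast_nonneg _
        have i1 : (hg S u : ℝ) * (e - hg S u) * e < a1 * c^2 := by
          have j0 : (1:ℝ) ≤ e := by exact_mod_cast he1
          calc (hg S u : ℝ) * (e - hg S u) * e ≤ a1 * e * e := by
                gcongr
                · linarith
            _ = a1 * e^2 := by ring
            _ < a1 * c^2 := by gcongr
        have : 120 * ((hg S u : ℝ) * (e - hg S u) * e) * x < 120 * (a1 * c^2) * x := by gcongr
        linarith
      rw [he]; push_cast; linarith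
    · exfalso
      rw [heq] at pu1 pu3
      rw [← he] at pu3
      have hz1 := Z0_gap hG hx hh hT hu
      have hz2 := Z0_gap hG hx hh hT hv
      rw [heq] at hz1
      have hvv : u + 2 * (e + hg S v) = v + 2 * hg S v := by omega
      have k := G3 hG hx hh hT H1 H2 (u := u) (a := e) (e := e + hg S v) pu1 (by omega) pu
        (by rw [← he]; exact pv) (by rw [hvv]; exact pv3)
      push_cast at k
      have j0 : (0:ℝ) ≤ e := by positivity
      have j1 : (0:ℝ) ≤ hg S v := by positivity
      generalize (hg S v : ℝ) = b at *
      generalize (e : ℝ) = a at *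
      have i1 : a * (a + b - a) * (a + b) ≤ a^3 + b^3 := by
        nlinarith [mul_nonneg (add_nonneg j0 j1) (sq_nonneg (a - b))]
      have i2 : 120 * (a * (a + b - a) * (a + b)) * x ≤ 120 * (a^3 + b^3) * x := by gcongr
      have i3 : 9 * T^4 ≤ 120 * (a^3+b^3) * x := by linarith
      have i4 : (100 * h) * T^3 ≤ T * T^3 := by gcongr
      have i5 : 0 < T^4 := by positivity
      linarith


theorem short_fib {x h T : ℝ} {S : Finset ℕ} {m : ℕ → ℤ} (hG : Good x h T S m)
    (hx : 0 < x) (hh : 0 < h) (hT : 0 < T)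
    (H1 : 5 * h * T^2 ≤ 12 * x) (H2 : 15 * h^2 ≤ x)
    (H3 : h ≤ 72/1000 * T) (H4 : 225 * h^3 ≤ x * T)
    (n a : ℕ) (B : ℝ) (hB : 0 < B) (ha0 : 1 ≤ a) (han : a ≤ n)
    (hBn : 320 * ((n:ℝ) * B^3) * x ≤ 9 * T^5) :
    ((((S1 S).filter (fun u => hg S u ≤ n ∧ NN m u (hg S u) ≠ 0)).filter (fun u => hg S u = a)).card : ℝ)
     ≤ 864/100 * x / T^4 * (a:ℝ)^3 + 401/100 * h / B := by
  set U := ((S1 S).filter (fun u => hg S u ≤ n ∧ NN m u (hg S u) ≠ 0)).filter (fun u => hg S u = a)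
    with hU
  have hUp : ∀ u ∈ U, u ∈ S1 S ∧ hg S u = a ∧ NN m u a ≠ 0 ∧ u ∈ S ∧ u + 2 * a ∈ S := by
    intro u hu
    simp only [hU, Finset.mem_filter] at hu
    obtain ⟨⟨u1, u2, u3⟩, u4⟩ := hu
    obtain ⟨pu, pu1, pu2, pu3⟩ := S1_prop hG u1
    rw [u4] at u3 pu3
    exact ⟨u1, u4, u3, pu, pu3⟩
  have ha' : (0:ℝ) < a := by exact_mod_cast ha0
  have hE : h / T ≤ 72/1000 := by rw [div_le_iff₀ hT]; exact H3
  have hE0 : 0 < h / T := by positivity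
  obtain ⟨Q, hQ⟩ : ∃ Q, Q = 4 * (a:ℝ)^3 * x * (1/T^4) := ⟨_, rfl⟩
  have hQ0 : 0 < Q := by rw [hQ]; positivity
  set k := ⌊Q + h / T⌋₊ with hk
  have hk1 : (k:ℝ) ≤ Q + h / T := Nat.floor_le (by positivity)
  have hk2 : (k:ℝ) ≤ 1000/928 * Q := by
    rcases Nat.eq_zero_or_pos k with h0 | h0
    · rw [h0]; simp; positivity
    · have : (1:ℝ) ≤ k := by exact_mod_cast h0
      nlinarith
  have hN : ∀ u ∈ U, 1 ≤ NN m u a ∧ (NN m u a).toNat ≤ k := by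
    intro u hu
    obtain ⟨u1, u2, u3, u4, u5⟩ := hUp u hu
    have g := abs_le.1 (GN hG hx hh hT ha0 u4 u5)
    obtain ⟨f1, f2⟩ := GF hG hx hT u4 u5
    have f0 : (0:ℝ) ≤ 4 * (a:ℝ)^3 * x * ((343/512)^4 / T^4) := by positivity
    have : (-1:ℝ) < NN m u a := by linarith [g.1]
    have : -1 < NN m u a := by exact_mod_cast this
    have h1 : 1 ≤ NN m u a := by omega
    refine ⟨h1, ?_⟩
    apply Nat.le_floor
    have : (((NN m u a).toNat : ℤ) : ℝ) = (NN m u a : ℝ) := by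
      rw [Int.toNat_of_nonneg (by omega)]
    rw [Int.cast_natCast] at this
    rw [this]
    linarith [g.2]
  obtain ⟨W, hW⟩ : ∃ W, W = h * T^4 / (16 * (343/512)^5 * a^3 * x) := ⟨_, rfl⟩
  have hW0 : 0 < W := by rw [hW]; positivity
  have hQW : Q * W = h / (4 * (343/512)^5) := by
    rw [hQ, hW]; field_simp; norm_num
  have hmaps : ∀ u ∈ U, (NN m u a).toNat ∈ Finset.Icc 1 k := by
    intro u hu
    obtain ⟨h1, h2⟩ := hN u hu
    rw [Finset.mem_Icc]
    omega
  have main : (U.card : ℝ) ≤ k * (2 * (1 + W / B)) := by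
    rw [Finset.card_eq_sum_card_fiberwise hmaps]
    push_cast
    calc ∑ b ∈ Finset.Icc 1 k, ((U.filter (fun u => (NN m u a).toNat = b)).card : ℝ)
        ≤ ∑ b ∈ Finset.Icc 1 k, (2 * (1 + W / B)) := by
          apply Finset.sum_le_sum
          intro b hb
          refine fiber_card hG hx hh hT H1 H2 H3 H4 _ a n B W hB hW0.le han hBn ?_ ?_
          · intro u hu
            have := hUp u (Finset.mem_filter.1 hu).1
            exact ⟨this.1, this.2.1⟩
          · intro u hu v hv huv
            obtain ⟨hu1, hu2⟩ := Finset.mem_filter.1 hu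
            obtain ⟨hv1, hv2⟩ := Finset.mem_filter.1 hv
            obtain ⟨-, -, -, u4, u5⟩ := hUp u hu1
            obtain ⟨-, -, -, v4, v5⟩ := hUp v hv1
            obtain ⟨c, hc1, hc⟩ := odd_diff hG u4 v4 huv
            have heq : NN m u a = NN m v a := by
              have := (hN u hu1).1
              have := (hN v hv1).1
              omega
            have g1 := abs_le.1 (GN hG hx hh hT ha0 u4 u5)
            have g2 := abs_le.1 (GN hG hx hh hT ha0 v4 v5)
            rw [heq] at g1
            have v5' := v5
            rw [hc] at v5'
            have gd := GD hG hx hT (a := a) (b := c) u4 v5'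
            rw [← hc] at gd
            have g3 : 4 * (a:ℝ)^3 * x * (8 * c * (343/512)^5 / T^5) ≤ 2 * (h / T) := by
              linarith [g1.1, g2.2]
            have g4 : (c:ℝ) ≤ W := by
              rw [hW, le_div_iff₀ (by positivity)]
              have := mul_le_mul_of_nonneg_right g3 (by positivity : 0 ≤ T^5 / 2)
              have e1 : 4 * (a:ℝ)^3 * x * (8 * c * (343/512)^5 / T^5) * (T^5 / 2) =
                c * (16 * (343/512)^5 * a^3 * x) := by field_simp; norm_num
              have e2 : 2 * (h / T) * (T^5/2) = h * T^4 := by field_simp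
              linarith
            rw [hc]; push_cast; linarith
      _ = k * (2 * (1 + W / B)) := by
          rw [Finset.sum_const, Nat.card_Icc]; simp
  have e1 : (k:ℝ) * (2 * (1 + W / B)) ≤ 1000/928 * Q * (2 * (1 + W / B)) := by gcongr
  have e2 : 1000/928 * Q * (2 * (1 + W / B)) = 2000/928 * Q + 2000/928 * (Q * W) / B := by ring
  have e3 : 2000/928 * Q ≤ 864/100 * x / T^4 * (a:ℝ)^3 := by
    have : 864/100 * x / T^4 * (a:ℝ)^3 = 216/100 * Q := by rw [hQ]; ring
    rw [this]; nlinarith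
  have e4 : 2000/928 * (Q * W) / B ≤ 401/100 * h / B := by
    rw [hQW]
    have : 2000/928 * (h / (4 * (343/512)^5)) ≤ 401/100 * h := by
      have : 2000/928 * (h / (4 * (343/512)^5)) = (2000/928 * (1 / (4 * (343/512)^5))) * h := by ring
      rw [this]
      have : (2000/928 * (1 / (4 * (343/512)^5)) : ℝ) ≤ 401/100 := by norm_num
      gcongr
    gcongr
  linarith

theorem short_card {x h T : ℝ} {S : Finset ℕ} {m : ℕ → ℤ} (hG : Good x h T S m)
    (hx : 0 < x) (hh : 0 < h) (hT : 0 < T)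
    (H1 : 5 * h * T^2 ≤ 12 * x) (H2 : 15 * h^2 ≤ x)
    (H3 : h ≤ 72/1000 * T) (H4 : 225 * h^3 ≤ x * T)
    (n : ℕ) (B : ℝ) (hB : 0 < B)
    (hBn : 320 * ((n:ℝ) * B^3) * x ≤ 9 * T^5) :
    (((S1 S).filter (fun u => hg S u ≤ n ∧ NN m u (hg S u) ≠ 0)).card : ℝ)
     ≤ 864/100 * x / T^4 * (((n:ℝ)+1)^4/4) + n * (401/100 * h / B) := by
  have hmaps : ∀ u ∈ (S1 S).filter (fun u => hg S u ≤ n ∧ NN m u (hg S u) ≠ 0),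
      hg S u ∈ Finset.Icc 1 n := by
    intro u hu
    obtain ⟨u1, u2⟩ := Finset.mem_filter.1 hu
    rw [Finset.mem_Icc]
    exact ⟨(S1_prop hG u1).2.1, u2.1⟩
  rw [Finset.card_eq_sum_card_fiberwise hmaps]
  push_cast
  have hs : ∀ n : ℕ, ∑ a ∈ Finset.Icc 1 n, (a:ℝ)^3 ≤ ((n:ℝ)+1)^4/4 := by
    intro n
    induction n with
    | zero => simp
    | succ k ih =>
      rw [Finset.sum_Icc_succ_top (by omega)]
      push_cast
      have : (0:ℝ) ≤ k := Nat.cast_nonneg k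
      nlinarith [pow_nonneg this 2, pow_nonneg this 3]
  refine le_trans (Finset.sum_le_sum (fun a ha => ?_)) (?_ : ∑ a ∈ Finset.Icc 1 n,
    (864/100 * x / T^4 * (a:ℝ)^3 + 401/100 * h / B) ≤ _)
  · rw [Finset.mem_Icc] at ha
    exact short_fib hG hx hh hT H1 H2 H3 H4 n a B hB ha.1 ha.2 hBn
  · rw [Finset.sum_add_distrib, ← Finset.mul_sum, Finset.sum_const, Nat.card_Icc]
    simp only [nsmul_eq_mul, Nat.add_sub_cancel]
    have := hs n
    gcongr

theorem step_card {x h T : ℝ} {S : Finset ℕ} {m : ℕ → ℤ} (hG : Good x h T S m)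
    (hx : 0 < x) (hh : 0 < h) (hT : 0 < T)
    (H1 : 5 * h * T^2 ≤ 12 * x) (H2 : 15 * h^2 ≤ x)
    (H3 : h ≤ 72/1000 * T) (H4 : 225 * h^3 ≤ x * T)
    (A B : ℝ) (hA : 2 ≤ A) (hB : 0 < B)
    (hBn : 160 * (A * B^3) * x ≤ 9 * T^5) :
    (S.card : ℝ) ≤ 2 + (169/343 * T) / A +
     (864/100 * x / T^4 * ((A/2+1)^4/4) + A/2 * (401/100 * h / B)) + (Z0 S m).card := by
  have h1 := card_S1 S
  set n := ⌊A/2⌋₊ with hn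
  have hn1 : (n:ℝ) ≤ A/2 := Nat.floor_le (by linarith)
  have hn2 : A/2 < n + 1 := Nat.lt_floor_add_one _
  have h2 := long_card hG hT n
  have h3 := short_card hG hx hh hT H1 H2 H3 H4 n B hB (by
    refine le_trans ?_ hBn
    have : 160 * (A * B^3) * x = 320 * ((A/2) * B^3) * x := by ring
    rw [this]
    gcongr)
  have hsub : S1 S ⊆ ((S1 S).filter (fun u => n < hg S u)) ∪
      (((S1 S).filter (fun u => hg S u ≤ n ∧ NN m u (hg S u) ≠ 0)) ∪ Z0 S m) := by
    intro u hu
    simp only [Finset.mem_union, Finset.mem_filter, Z0]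
    by_cases c1 : n < hg S u
    · left; exact ⟨hu, c1⟩
    · right
      by_cases c2 : NN m u (hg S u) = 0
      · right; exact ⟨hu, c2⟩
      · left; exact ⟨hu, by omega, c2⟩
  have h4 := (Finset.card_le_card hsub).trans ((Finset.card_union_le _ _).trans
    (Nat.add_le_add_left (Finset.card_union_le _ _) _))
  have h5 : (S.card : ℝ) ≤ ((S1 S).filter (fun u => n < hg S u)).card +
      (((S1 S).filter (fun u => hg S u ≤ n ∧ NN m u (hg S u) ≠ 0)).card + (Z0 S m).card) + 1 := by
    exact_mod_cast h1.trans (Nat.add_le_add_right h4 1)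
  have h6 : (169/343 * T) / (2 * ((n:ℝ) + 1)) ≤ (169/343 * T) / A := by
    apply div_le_div_of_nonneg_left (by positivity) (by linarith) (by linarith)
  have h7 : 864/100 * x / T^4 * (((n:ℝ)+1)^4/4) ≤ 864/100 * x / T^4 * ((A/2+1)^4/4) := by gcongr
  have h8 : n * (401/100 * h / B) ≤ A/2 * (401/100 * h / B) := by gcongr
  linarith

/-- the final range: no vanishing at all -/
theorem last_card {x h T : ℝ} {S : Finset ℕ} {m : ℕ → ℤ} (hG : Good x h T S m)
    (hx : 0 < x) (hh : 0 < h) (hT : 0 < T)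
    (H3 : h ≤ 72/1000 * T) (H5 : h ≤ x) (H6 : 3000 * h * x^2 < T^6)
    (c : ℝ) (hc : 0 < c) (hcn : 1000 * (4 * c^3 * x) ≤ 928 * T^4) :
    (S.card : ℝ) ≤ 1 + (169/343 * T) / (2 * c) := by
  refine spacing_card1 _ T (169/343 * T) (2 * c) (by positivity) ?_ ?_ (by positivity)
  · intro u hu
    obtain ⟨h1, h2, -⟩ := hG u hu
    exact ⟨h1, by linarith⟩
  · intro u hu v hv huv
    obtain ⟨a, ha1, ha⟩ := odd_diff hG hu hv huv
    have hv' := hv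
    rw [ha] at hv'
    have g := abs_le.1 (GN hG hx hh hT ha1 hu hv')
    obtain ⟨f1, f2⟩ := GF hG hx hT hu hv'
    have ha' : (1:ℝ) ≤ a := by exact_mod_cast ha1
    have f0 : (0:ℝ) ≤ 4 * (a:ℝ)^3 * x * ((343/512)^4 / T^4) := by positivity
    have hE : h / T ≤ 72/1000 := by rw [div_le_iff₀ hT]; exact H3
    have i1 : (-1:ℝ) < NN m u a := by linarith [g.1]
    have i2 : -1 < NN m u a := by exact_mod_cast i1
    have hne : NN m u a ≠ 0 := by
      intro h0
      obtain ⟨t1, t2, -, t3, t4⟩ := hG u hu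
      have hm0 : 0 < m u := by
        by_contra hcon
        push Not at hcon
        have : (m u : ℝ) ≤ 0 := by exact_mod_cast hcon
        nlinarith [sq_nonneg (u:ℝ)]
      have hdvd : ((u:ℤ) + 3 * a) ∣ 4 * a * m u := by
        unfold NN at h0
        refine ⟨m u - m (u + 2 * a), ?_⟩
        linear_combination h0
      have hle := Int.le_of_dvd (by positivity) hdvd
      have hle' : (u:ℝ) + 3 * a ≤ 4 * a * m u := by exact_mod_cast hle
      have hTa : T ≤ 4 * a * m u := by linarith
      have hm1 : (m u : ℝ) * T^2 ≤ 2 * x := by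
        have : (m u : ℝ) * T^2 ≤ m u * (u:ℝ)^2 := by
          have : (0:ℝ) ≤ m u := by exact_mod_cast hm0.le
          gcongr
        linarith
      have hTa2 : T^3 ≤ 8 * a * x := by
        calc T^3 = T * T^2 := by ring
          _ ≤ 4 * a * m u * T^2 := by gcongr
          _ = 4 * a * (m u * T^2) := by ring
          _ ≤ 4 * a * (2 * x) := by gcongr
          _ = _ := by ring
      have k3 : 4 * (a:ℝ)^3 * x * ((343/512)^4 / T^4) ≤ h / T := by
        rw [h0] at g
        have := g.1
        push_cast at this
        linarith
      have k5 := mul_le_mul_of_nonneg_right k3 (by positivity : 0 ≤ T^4)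
      have e1 : 4 * (a : ℝ)^3 * x * ((343/512)^4 / T^4) * T^4 = 4 * (a : ℝ)^3 * x * (343/512)^4 := by
        field_simp
      have e2 : h / T * T^4 = h * T^3 := by field_simp
      have k6 : 4 * (a : ℝ)^3 * x * (343/512)^4 ≤ h * T^3 := by linarith
      have k7 : (T^3)^3 ≤ (8 * a * x)^3 := by gcongr
      have k8 : T^6 * T^3 ≤ 3000 * h * x^2 * T^3 := by
        have : (343/512:ℝ)^4 ≥ 2/10 := by norm_num
        have j : (8 * a * x)^3 * (8/10) ≤ 512 * x^2 * (4 * (a : ℝ)^3 * x * (343/512)^4) := by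
          have : 0 ≤ 512 * x^2 * (4 * (a : ℝ)^3 * x) := by positivity
          nlinarith
        have j2 : 512 * x^2 * (4 * (a : ℝ)^3 * x * (343/512)^4) ≤ 512 * x^2 * (h * T^3) := by gcongr
        have j3 : 0 ≤ h * x^2 * T^3 := by positivity
        linarith
      have : 3000 * h * x^2 * T^3 < T^6 * T^3 := by gcongr
      linarith
    have i3 : 1 ≤ NN m u a := by omega
    have i4 : (1:ℝ) ≤ NN m u a := by exact_mod_cast i3
    have i5 : 928/1000 ≤ 4 * (a:ℝ)^3 * x * (1/T^4) := by linarith [g.2]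
    have i6 : 928 * T^4 ≤ 1000 * (4 * (a:ℝ)^3 * x) := by
      have := mul_le_mul_of_nonneg_right i5 (by positivity : 0 ≤ T^4)
      have e : 4 * (a:ℝ)^3 * x * (1/T^4) * T^4 = 4 * (a:ℝ)^3 * x := by field_simp
      linarith
    have hca : c ≤ a := by
      by_contra hcon
      push Not at hcon
      have : 1000 * (4 * (a:ℝ)^3 * x) < 1000 * (4 * c^3 * x) := by gcongr
      linarith
    rw [ha]; push_cast; linarith


lemma hyps (w L s : ℝ) (hL : 1800 ≤ L) (hw : 10^6 * L^7 ≤ w^3) (hw1 : 1 ≤ w) (hs : 0 < s)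
    (hs1 : L^2/64 ≤ s^3) (hs2 : s^3 * L ≤ w^9) :
    5*(2*w^9*L)*(w^9*s^3)^2 ≤ 12*w^45 ∧ 15*(2*w^9*L)^2 ≤ w^45 ∧ 2*w^9*L ≤ 72/1000*(w^9*s^3) ∧
    225*(2*w^9*L)^3 ≤ w^45*(w^9*s^3) := by
  have hL0 : 0 < L := by linarith
  have hw0 : 0 < w := by linarith
  have hs3 : 50625 ≤ s^3 := by nlinarith
  have hp : ∀ n : ℕ, 1 ≤ L^n := fun n => one_le_pow₀ (by linarith)
  have h9 : w^3 ≤ w^9 := pow_le_pow_right₀ hw1 (by norm_num)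
  have hX1 : 1 ≤ w^9 := one_le_pow₀ hw1
  have hLX : ∀ n : ℕ, n ≤ 7 → 10^6 * L^n ≤ w^9 := fun n hn => by
    have : L^n ≤ L^7 := pow_le_pow_right₀ (by linarith) hn
    linarith
  have l2 := hLX 2 (by norm_num)
  have l3 := hLX 3 (by norm_num)
  refine ⟨?_, ?_, ?_, ?_⟩
  · have h1 : (s^3*L)^2 ≤ (w^9)^2 := by gcongr
    have h2 : s^6 * L ≤ (w^9)^2 := by
      have : s^6*L ≤ s^6*L^2 := by
        have : 0 < s^6 := by positivity
        nlinarith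
      nlinarith
    have : 5*(2*w^9*L)*(w^9*s^3)^2 = 10*(w^9)^3*(s^6*L) := by ring
    rw [this, show 12*w^45 = 12*((w^9)^3*(w^9)^2) by ring]
    have : (w^9)^3*(s^6*L) ≤ (w^9)^3*(w^9)^2 := by gcongr
    have : 0 ≤ (w^9)^3*(w^9)^2 := by positivity
    linarith
  · rw [show 15*(2*w^9*L)^2 = (w^9)^2*(60*L^2) by ring, show w^45 = (w^9)^2*((w^9)*(w^9)^2) by ring]
    have : w^9 * 1 ≤ w^9*(w^9)^2 := by gcongr; exact one_le_pow₀ hX1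
    refine mul_le_mul_of_nonneg_left ?_ (by positivity)
    nlinarith [hp 2]
  · have : 2*L ≤ 72/1000*s^3 := by nlinarith
    calc 2*w^9*L = w^9*(2*L) := by ring
      _ ≤ w^9*(72/1000*s^3) := by gcongr
      _ = _ := by ring
  · rw [show 225*(2*w^9*L)^3 = (w^9)^3*(1800*L^3) by ring, show w^45*(w^9*s^3) = (w^9)^3*(w^9*((w^9)^2*s^3)) by ring]
    have : w^9 * 1 ≤ w^9*((w^9)^2*s^3) := by
      gcongr
      have : 1 ≤ (w^9)^2 := one_le_pow₀ hX1
      nlinarith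
    refine mul_le_mul_of_nonneg_left ?_ (by positivity)
    nlinarith [hp 3]

lemma stepX {x h T : ℝ} {S : Finset ℕ} {m : ℕ → ℤ} (hG : Good x h T S m) (w L s : ℝ)
    (hL : 1800 ≤ L) (hw : 10^6 * L^7 ≤ w^3) (hw1 : 1 ≤ w) (hs : 0 < s)
    (hs1 : L^2/64 ≤ s^3) (hs2 : s^3 * L ≤ w^9) (hx : x = w^45) (hh : h = 2*w^9*L)
    (hT : T = w^9*s^3) (θ κ : ℝ) (hθ : 1/15 ≤ θ) (hκ : 0 < κ) (hk : 160*θ*κ^3 ≤ 9) :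
    (S.card:ℝ) ≤ 2 + 169/343*w^9/θ + 216/100*w^9*(θ/2+1/50625)^4 + 401/100*θ/κ*(w^9*L/s)
      + (Z0 S m).card := by
  have hL0 : 0 < L := by linarith
  have hw0 : 0 < w := by linarith
  have hs3 : 50625 ≤ s^3 := by nlinarith
  obtain ⟨H1, H2, H3, H4⟩ := hyps w L s hL hw hw1 hs hs1 hs2
  rw [← hx, ← hh] at H2; rw [← hh, ← hT] at H3; rw [← hx, ← hh, ← hT] at H1 H4
  have hθ0 : 0 < θ := by linarith
  have := step_card hG (by rw [hx]; positivity) (by rw [hh]; positivity) (by rw [hT]; positivity)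
    H1 H2 H3 H4 (θ*s^3) (κ*s^4) (by nlinarith) (by positivity) (by
      rw [hx, hT]
      have : 160*(θ*s^3*(κ*s^4)^3)*w^45 = (160*θ*κ^3)*(s^15*w^45) := by ring
      rw [this, show 9*(w^9*s^3)^5 = 9*(s^15*w^45) by ring]
      gcongr)
  refine this.trans ?_
  have e1 : (169/343*T)/(θ*s^3) = 169/343*w^9/θ := by rw [hT]; field_simp
  have e2 : 864/100*x/T^4*((θ*s^3/2+1)^4/4) = 216/100*w^9*(θ/2+1/s^3)^4 := by
    rw [hT, hx]; field_simp; ring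
  have e3 : θ*s^3/2*(401/100*h/(κ*s^4)) = 401/100*θ/κ*(w^9*L/s) := by
    rw [hh]; field_simp
  rw [e1, e2, e3]
  have : 216/100*w^9*(θ/2+1/s^3)^4 ≤ 216/100*w^9*(θ/2+1/50625)^4 := by
    gcongr
  linarith

lemma zA {x h T : ℝ} {S : Finset ℕ} {m : ℕ → ℤ} (hG : Good x h T S m) (w L s ρ : ℝ)
    (hL : 1800 ≤ L) (hw : 10^6 * L^7 ≤ w^3) (hw1 : 1 ≤ w) (hs : 0 < s)
    (hs1 : L^2/64 ≤ s^3) (hs2 : s^3 * L ≤ w^9) (hx : x = w^45) (hh : h = 2*w^9*L)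
    (hT : T = w^9*s^3) (hρ : 0 < ρ) (hρ9 : ρ^9 = 249/100*L) :
    ((Z0 S m).card:ℝ) ≤ 2*ρ^3*s^3/w^3 + 1621/1000*ρ^4*w^5*s^2 := by
  have hL0 : 0 < L := by linarith
  have hw0 : 0 < w := by linarith
  obtain ⟨H1, H2, H3, H4⟩ := hyps w L s hL hw hw1 hs hs1 hs2
  rw [← hx, ← hh] at H2; rw [← hh, ← hT] at H3; rw [← hx, ← hh, ← hT] at H1 H4
  have := Z0_card4 hG (by rw [hx]; positivity) (by rw [hh]; positivity) (by rw [hT]; positivity)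
    H1 H2 H3 H4 (ρ^3*s^3/w^3) (304/1000*s^4*w/ρ) (by positivity) (by positivity) (by
      rw [hx, hT]
      have : 320*(ρ^3*s^3/w^3*(304/1000*s^4*w/ρ)^3)*w^45 = 320*(304/1000)^3*(s^15*w^45) := by
        field_simp
      rw [this, show 9*(w^9*s^3)^5 = 9*(s^15*w^45) by ring]
      gcongr
      norm_num) (by
      rw [hx, hT, hh]
      have : 4*(ρ^3*s^3/w^3)^3*w^45*(343/512)^4 = 4*(343/512)^4*ρ^9*(s^9*w^36) := by
        field_simp
      rw [this, hρ9, show 2*w^9*L*(w^9*s^3)^3 = (2*L)*(s^9*w^36) by ring]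
      refine mul_le_mul_of_nonneg_right ?_ (by positivity)
      norm_num
      linarith)
  refine this.trans ?_
  have e : ρ^3*s^3/w^3*(2*(1+(169/686*T)/(304/1000*s^4*w/ρ))) = 2*ρ^3*s^3/w^3 +
    (2*(169/686)/(304/1000))*(ρ^4*w^5*s^2) := by rw [hT]; field_simp
  rw [e, show 1621/1000*ρ^4*w^5*s^2 = 1621/1000*(ρ^4*w^5*s^2) by ring]
  refine add_le_add le_rfl (mul_le_mul_of_nonneg_right (by norm_num) (by positivity))

lemma zB {x h T : ℝ} {S : Finset ℕ} {m : ℕ → ℤ} (hG : Good x h T S m) (w L s ρ : ℝ)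
    (hL : 1800 ≤ L) (hw : 10^6 * L^7 ≤ w^3) (hw1 : 1 ≤ w) (hs : 0 < s)
    (hs1 : L^2/64 ≤ s^3) (hs2 : s^3 * L ≤ w^9) (hx : x = w^45) (hh : h = 2*w^9*L)
    (hT : T = w^9*s^3) (hρ : 0 < ρ) (hρ9 : ρ^9 = 249/100*L)
    (hρ3 : ρ^3 ≤ 375/10000*(L/85)^2) (hsw : w^2/2 ≤ s) :
    ((Z0 S m).card:ℝ) ≤ 1 + 24636/100000*(L/85)*w^11/s := by
  have hL0 : 0 < L := by linarith
  have hw0 : 0 < w := by linarith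
  obtain ⟨H1, H2, H3, H4⟩ := hyps w L s hL hw hw1 hs hs1 hs2
  rw [← hx, ← hh] at H2; rw [← hh, ← hT] at H3; rw [← hx, ← hh, ← hT] at H1 H4
  have h200 : 200*L ≤ s^3 := by
    have h1 : (w^2/2)^3 ≤ s^3 := by gcongr
    have h2 : L^1 ≤ L^7 := pow_le_pow_right₀ (by linarith) (by norm_num)
    have h3 : w^3 ≤ w^6 := pow_le_pow_right₀ hw1 (by norm_num)
    nlinarith
  have := Z0_card3 hG (by rw [hx]; positivity) (by rw [hh]; positivity) (by rw [hT]; positivity)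
    H1 H2 (by rw [hh, hT]; nlinarith [pow_pos hw0 9]) (ρ^3*s^3/w^3) (s^4/w^2/(L/85)) (by positivity) (by positivity) (by
      rw [hx, hT]
      have : 120*(ρ^3*s^3/w^3*(s^4/w^2/(L/85))^2)*w^45 = 120*(ρ^3/(L/85)^2)*(s^11*w^38) := by
        field_simp
      rw [this, show 9*(w^9*s^3)^4 = 9*(s^11*(w^36*s)) by ring]
      have h1 : ρ^3/(L/85)^2 ≤ 375/10000 := by
        rw [div_le_iff₀ (by positivity)]; exact hρ3
      have h2 : s^11*(w^36*(w^2/2)) ≤ s^11*(w^36*s) := by gcongr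
      have h3 : 0 < s^11*w^38 := by positivity
      calc 120*(ρ^3/(L/85)^2)*(s^11*w^38) ≤ 120*(375/10000)*(s^11*w^38) := by gcongr
        _ = 9*(s^11*(w^36*(w^2/2))) := by ring
        _ ≤ _ := by gcongr) (by
      rw [hx, hT, hh]
      have : 4*(ρ^3*s^3/w^3)^3*w^45*(343/512)^4 = 4*(343/512)^4*ρ^9*(s^9*w^36) := by
        field_simp
      rw [this, hρ9, show 2*w^9*L*(w^9*s^3)^3 = (2*L)*(s^9*w^36) by ring]
      refine mul_le_mul_of_nonneg_right ?_ (by positivity)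
      norm_num
      linarith)
  refine this.trans ?_
  have e : (169/343*T)/(2*(s^4/w^2/(L/85))) = (169/686)*((L/85)*w^11/s) := by
    rw [hT]; field_simp; norm_num
  rw [e, show 24636/100000*(L/85)*w^11/s = 24636/100000*((L/85)*w^11/s) by ring]
  refine add_le_add le_rfl (mul_le_mul_of_nonneg_right (by norm_num) (by positivity))

lemma lastX {x h T : ℝ} {S : Finset ℕ} {m : ℕ → ℤ} (hG : Good x h T S m) (w L s : ℝ)
    (hL : 1800 ≤ L) (hw : 10^6 * L^7 ≤ w^3) (hw1 : 1 ≤ w) (hs : 0 < s)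
    (hs1 : L^2/64 ≤ s^3) (hs2 : w^9 ≤ s^3*L) (hx : x = w^45) (hh : h = 2*w^9*L)
    (hT : T = w^9*s^3) :
    (S.card:ℝ) ≤ 1 + 4013/10000*w^12/s := by
  have hL0 : 0 < L := by linarith
  have hw0 : 0 < w := by linarith
  have h9 : w^3 ≤ w^9 := pow_le_pow_right₀ hw1 (by norm_num)
  have := last_card hG (by rw [hx]; positivity) (by rw [hh]; positivity) (by rw [hT]; positivity)
    (by
      rw [hh, hT]
      have : 2*L ≤ 72/1000*s^3 := by nlinarith
      calc 2*w^9*L = w^9*(2*L) := by ring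
        _ ≤ w^9*(72/1000*s^3) := by gcongr
        _ = _ := by ring) (by
      rw [hh, hx]
      have h2 : L^1 ≤ L^7 := pow_le_pow_right₀ (by linarith) (by norm_num)
      have h3 : w^3 ≤ w^36 := pow_le_pow_right₀ hw1 (by norm_num)
      calc 2*w^9*L = w^9*(2*L) := by ring
        _ ≤ w^9*w^36 := by gcongr; nlinarith
        _ = _ := by ring) (by
      rw [hh, hx, hT]
      have h1 : (w^9)^6 ≤ (s^3*L)^6 := by gcongr
      have h2 : 6000*L^7 < w^9 := by
        have : 0 < L^7 := by positivity
        linarith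
      have h3 : (6000*L^7)*(w^9)^5 < (w^9)*(w^9)^5 := by gcongr
      have h4 : (6000*L)*(w^9)^5*L^6 < s^18*L^6 := by nlinarith
      have h5 : (6000*L)*(w^9)^5 < s^18 := lt_of_mul_lt_mul_right h4 (by positivity)
      calc 3000*(2*w^9*L)*(w^45)^2 = (w^9)^6*((6000*L)*(w^9)^5) := by ring
        _ < (w^9)^6*s^18 := by gcongr
        _ = _ := by ring) (614/1000*s^4/w^3) (by positivity) (by
      rw [hx, hT]
      have : 1000*(4*(614/1000*s^4/w^3)^3*w^45) = 4000*(614/1000)^3*(s^12*w^36) := by field_simp; norm_num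
      rw [this, show 928*(w^9*s^3)^4 = 928*(s^12*w^36) by ring]
      gcongr
      norm_num)
  refine this.trans ?_
  have e : (169/343*T)/(2*(614/1000*s^4/w^3)) = (169/343/(2*614/1000))*(w^12/s) := by
    rw [hT]; field_simp
  rw [e, show 4013/10000*w^12/s = 4013/10000*(w^12/s) by ring]
  refine add_le_add le_rfl (mul_le_mul_of_nonneg_right (by norm_num) (by positivity))


lemma geo_inv (s0 M : ℝ) (hs : 0 < s0) (hM : 0 < M) (n : ℕ) :
    ∑ j ∈ Finset.range n, (if M ≤ s0*(8/7)^j then 1/(s0*(8/7)^j) else 0) ≤ 8/M := by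
  suffices h : ∑ j ∈ Finset.range n, (if M ≤ s0*(8/7)^j then 1/(s0*(8/7)^j) else 0)
      ≤ 8*(1/M - min (1/M) (1/(s0*(8/7)^n))) by
    have : 0 < min (1/M) (1/(s0*(8/7)^n)) := by positivity
    calc _ ≤ _ := h
      _ ≤ 8*(1/M) := by linarith
      _ = _ := by ring
  induction n with
  | zero => simp
  | succ n ih =>
    rw [Finset.sum_range_succ]
    have e : 1/(s0*(8/7)^(n+1)) = 7/8*(1/(s0*(8/7)^n)) := by
      rw [pow_succ]; field_simp
    rw [e]
    have hp : 0 < 1/(s0*(8/7)^n) := by positivity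
    split_ifs with hc
    · have : 1/(s0*(8/7)^n) ≤ 1/M := one_div_le_one_div_of_le hM hc
      rw [min_eq_right this] at ih
      rw [min_eq_right (by linarith)]
      linarith
    · have : min (1/M) (7/8*(1/(s0*(8/7)^n))) ≤ min (1/M) (1/(s0*(8/7)^n)) :=
        min_le_min_left _ (by linarith)
      linarith

lemma geo_sq (s0 M : ℝ) (hs : 0 < s0) (hM : 0 < M) (n : ℕ) :
    ∑ j ∈ Finset.range n, (if s0*(8/7)^j ≤ M then (s0*(8/7)^j)^2 else 0) ≤ 64/15*M^2 := by
  suffices h : ∑ j ∈ Finset.range n, (if s0*(8/7)^j ≤ M then (s0*(8/7)^j)^2 else 0)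
      ≤ 49/15*(min (8/7*M) (s0*(8/7)^n))^2 by
    have : min (8/7*M) (s0*(8/7)^n) ≤ 8/7*M := min_le_left _ _
    have h0 : 0 < min (8/7*M) (s0*(8/7)^n) := by positivity
    calc _ ≤ _ := h
      _ ≤ 49/15*(8/7*M)^2 := by gcongr
      _ = _ := by ring
  induction n with
  | zero => simp; positivity
  | succ n ih =>
    rw [Finset.sum_range_succ]
    have e : s0*(8/7)^(n+1) = 8/7*(s0*(8/7)^n) := by
      rw [pow_succ]; ring
    rw [e]
    have hp : 0 < s0*(8/7)^n := by positivity
    have h0 : 0 < min (8/7*M) (s0*(8/7)^n) := by positivity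
    split_ifs with hc
    · rw [min_eq_right (by linarith)] at ih
      rw [min_eq_right (by linarith)]
      linarith
    · have : min (8/7*M) (s0*(8/7)^n) ≤ min (8/7*M) (8/7*(s0*(8/7)^n)) :=
        min_le_min_left _ (by linarith)
      have : (min (8/7*M) (s0*(8/7)^n))^2 ≤ (min (8/7*M) (8/7*(s0*(8/7)^n)))^2 := by gcongr
      linarith

lemma stepAll {x h T : ℝ} {S : Finset ℕ} {m : ℕ → ℤ} (hG : Good x h T S m) (w L s ρ : ℝ) (j : ℕ)
    (hL : 1800 ≤ L) (hw : 10^6 * L^7 ≤ w^3) (hw1 : 1 ≤ w) (hs : 0 < s)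
    (hs1 : L^2/64 ≤ s^3) (hx : x = w^45) (hh : h = 2*w^9*L)
    (hT : T = w^9*s^3) (hρ : 0 < ρ) (hρ9 : ρ^9 = 249/100*L)
    (hρ3 : ρ^3 ≤ 375/10000*(L/85)^2) (hρ4 : ρ^4 ≤ L/42) :
    (S.card:ℝ) ≤ 1/1000*w^9 + (if j < 30 then 7392/1000*w^9 else 0)
      + (if s^3*L ≤ w^9 then 628/1000*w^9 else 0) + 2833/10000*(w^9*L)*(1/s)
      + 1047/100*(w^9*L)*(if 30 ≤ j then 1/s else 0)
      + 1621/1000*(L/42)*w^5*(if s ≤ w^2/2 then s^2 else 0)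
      + 24636/100000*(L/85)*w^11*(if w^2/2 ≤ s then 1/s else 0)
      + 4013/10000*w^12*(if 140*w^3/L ≤ s then 1/s else 0) := by
  have hL0 : 0 < L := by linarith
  have hw0 : 0 < w := by linarith
  have h9 : w^3 ≤ w^9 := pow_le_pow_right₀ hw1 (by norm_num)
  have hL7 : 1800 ≤ L^7 := by
    have := pow_le_pow_right₀ (by linarith : 1 ≤ L) (show 1 ≤ 7 by norm_num)
    linarith
  have p1 : 0 ≤ (if j < 30 then 7392/1000*w^9 else 0) := by split_ifs <;> positivity
  have p2 : 0 ≤ (if s^3*L ≤ w^9 then 628/1000*w^9 else 0) := by split_ifs <;> positivity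
  have p3 : 0 ≤ 1047/100*(w^9*L)*(if 30 ≤ j then 1/s else 0) := by split_ifs <;> positivity
  have p4 : 0 ≤ 1621/1000*(L/42)*w^5*(if s ≤ w^2/2 then s^2 else 0) := by split_ifs <;> positivity
  have p5 : 0 ≤ 24636/100000*(L/85)*w^11*(if w^2/2 ≤ s then 1/s else 0) := by
    split_ifs <;> positivity
  have p6 : 0 ≤ 4013/10000*w^12*(if 140*w^3/L ≤ s then 1/s else 0) := by split_ifs <;> positivity
  have p7 : 0 ≤ 2833/10000*(w^9*L)*(1/s) := by positivity
  by_cases hc : s^3*L ≤ w^9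
  · rw [if_pos hc] at p2 ⊢
    have hZ : ((Z0 S m).card:ℝ) ≤ 1/2000*w^9 + 1621/1000*(L/42)*w^5*(if s ≤ w^2/2 then s^2 else 0)
      + 24636/100000*(L/85)*w^11*(if w^2/2 ≤ s then 1/s else 0) := by
      rcases le_total s (w^2/2) with h2 | h2
      · have := zA hG w L s ρ hL hw hw1 hs hs1 hc hx hh hT hρ hρ9
        rw [if_pos h2]
        have a1 : 2*ρ^3*s^3/w^3 ≤ 1/2000*w^9 := by
          rw [div_le_iff₀ (by positivity)]
          have b1 : s^3 ≤ (w^2/2)^3 := by gcongr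
          have b2 : ρ^3 ≤ L^7 := by
            have : L^2 ≤ L^7 := pow_le_pow_right₀ (by linarith) (by norm_num)
            nlinarith
          calc 2*ρ^3*s^3 ≤ 2*L^7*(w^2/2)^3 := by gcongr
            _ = (1/4*L^7)*w^6 := by ring
            _ ≤ (1/2000*w^3)*w^6 := mul_le_mul_of_nonneg_right (by linarith) (by positivity)
            _ = 1/2000*w^9*1 := by ring
            _ ≤ 1/2000*w^9*w^3 := by gcongr; exact one_le_pow₀ hw1
        have a2 : 1621/1000*ρ^4*w^5*s^2 ≤ 1621/1000*(L/42)*w^5*s^2 := by gcongr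
        linarith
      · have := zB hG w L s ρ hL hw hw1 hs hs1 hc hx hh hT hρ hρ9 hρ3 h2
        rw [if_pos h2]
        have : 24636/100000*(L/85)*w^11/s = 24636/100000*(L/85)*w^11*(1/s) := by ring
        linarith
    by_cases hj : j < 30
    · have := stepX hG w L s hL hw hw1 hs hs1 hc hx hh hT (1/15) (944/1000) le_rfl (by norm_num) (by norm_num)
      rw [if_pos hj]
      have e : 401/100*(1/15)/(944/1000)*(w^9*L/s) ≤ 2833/10000*(w^9*L)*(1/s) := by
        have hq : 0 < w^9*L*(1/s) := by positivity
        rw [show w^9*L/s = w^9*L*(1/s) by ring]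
        linarith
      have e2 : 169/343*w^9/(1/15) + 216/100*w^9*((1/15)/2+1/50625)^4 ≤ 73915/10000*w^9 := by
        nlinarith [pow_pos hw0 9]
      linarith
    · have := stepX hG w L s hL hw hw1 hs hs1 hc hx hh hT 1 (383/1000) (by norm_num) (by norm_num) (by norm_num)
      rw [if_neg hj, if_pos (not_lt.1 hj)]
      have e : 401/100*1/(383/1000)*(w^9*L/s) ≤ 1048/100*(w^9*L)*(1/s) := by
        have hq : 0 < w^9*L*(1/s) := by positivity
        rw [show w^9*L/s = w^9*L*(1/s) by ring]
        linarith
      have e2 : 169/343*w^9/1 + 216/100*w^9*(1/2+1/50625)^4 ≤ 628/1000*w^9 := by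
        nlinarith [pow_pos hw0 9]
      have : 0 < w^9*L*(1/s) := by positivity
      linarith
  · have hc' : w^9 ≤ s^3*L := by linarith
    have := lastX hG w L s hL hw hw1 hs hs1 hc' hx hh hT
    have h2 : 140*w^3/L ≤ s := by
      refine le_of_pow_le_pow_left₀ (n := 3) (by norm_num) hs.le ?_
      have : (140*w^3/L)^3 = 2744000*w^9/L^3 := by ring
      rw [this, div_le_iff₀ (by positivity)]
      calc 2744000*w^9 ≤ L^2 * (s^3*L) := by gcongr; nlinarith
        _ = _ := by ring
    rw [if_pos h2] at p6 ⊢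
    have : 4013/10000*w^12/s = 4013/10000*w^12*(1/s) := by ring
    linarith

lemma sum_bound (w L s0 ρ : ℝ) (N : ℕ) (S : ℕ → Finset ℕ) (m : ℕ → ℤ)
    (hL : 1800 ≤ L) (hw : 10^6 * L^7 ≤ w^3) (hw1 : 1 ≤ w) (hs : 0 < s0) (hwe : w^9 = Real.exp (L/5))
    (hs1 : L^2/64 = s0^3) (hρ : 0 < ρ) (hρ9 : ρ^9 = 249/100*L) (hN : (N:ℝ) ≤ 11/10*L)
    (hG : ∀ j < N, Good (w^45) (2*w^9*L) (w^9*(s0*(8/7)^j)^3) (S j) m) :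
    ∑ j ∈ Finset.range N, ((S j).card : ℝ) ≤ 7/10*(w^9*L) := by
  have hL0 : 0 < L := by linarith
  have hw0 : 0 < w := by linarith
  have hX : 0 < w^9 := by positivity
  have hXL : 1800 * w^9 ≤ w^9*L := by nlinarith
  have hs36 : 369/10 ≤ s0 := by
    refine le_of_pow_le_pow_left₀ (n := 3) (by norm_num) hs.le ?_
    rw [← hs1]; nlinarith
  have hL5 : (1800:ℝ)^5 ≤ L^5 := by gcongr
  have hρ3 : ρ^3 ≤ 375/10000*(L/85)^2 := by
    refine le_of_pow_le_pow_left₀ (n := 3) (by norm_num) (by positivity) ?_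
    have e1 : (ρ^3)^3 = 249/100*L := by rw [← hρ9]; ring
    have e2 : (375/10000*(L/85)^2)^3 = (375/10000)^3/85^6*L*L^5 := by ring
    rw [e1, e2]
    have : (249/100:ℝ) ≤ (375/10000)^3/85^6*L^5 := by
      calc (249/100:ℝ) ≤ (375/10000)^3/85^6*1800^5 := by norm_num
        _ ≤ _ := by gcongr
    nlinarith
  have hρ4 : ρ^4 ≤ L/42 := by
    refine le_of_pow_le_pow_left₀ (n := 9) (by norm_num) (by positivity) ?_
    have e1 : (ρ^4)^9 = (249/100)^4*L^4 := by
      rw [← mul_pow, ← hρ9]; ring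
    have e2 : (L/42)^9 = L^4*(L^5/42^9) := by ring
    rw [e1, e2, mul_comm]
    gcongr
    calc ((249/100)^4:ℝ) ≤ 1800^5/42^9 := by norm_num
      _ ≤ _ := by gcongr
  have key : ∀ j ∈ Finset.range N, _ := fun j hj =>
    stepAll (hG j (Finset.mem_range.1 hj)) w L (s0*(8/7)^j) ρ j hL hw hw1 (by positivity) (by
      rw [hs1]
      have : (1:ℝ) ≤ (8/7)^j := one_le_pow₀ (by norm_num)
      have : s0 ≤ s0*(8/7)^j := by nlinarith
      gcongr) rfl rfl rfl hρ hρ9 hρ3 hρ4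
  refine (Finset.sum_le_sum key).trans ?_
  simp only [Finset.sum_add_distrib, ← Finset.mul_sum]
  have t1 : ∑ j ∈ Finset.range N, 1/1000*w^9 ≤ 11/10000*(w^9*L) := by
    rw [Finset.sum_const, Finset.card_range, nsmul_eq_mul]
    nlinarith
  have t2 : ∑ j ∈ Finset.range N, (if j < 30 then 7392/1000*w^9 else 0) ≤ 30*(7392/1000*w^9) := by
    rw [← Finset.sum_filter, Finset.sum_const, nsmul_eq_mul]
    gcongr
    have : (Finset.range N).filter (fun j => j < 30) ⊆ Finset.range 30 := by
      intro j hj; simp at hj ⊢; exact hj.2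
    have := Finset.card_le_card this
    simp at this
    exact_mod_cast this
  have t3 : ∑ j ∈ Finset.range N, (if (s0*(8/7)^j)^3*L ≤ w^9 then 628/1000*w^9 else 0)
      ≤ (8*L/15+1)*(628/1000*w^9) := by
    rw [← Finset.sum_filter, Finset.sum_const, nsmul_eq_mul]
    gcongr
    have : (Finset.range N).filter (fun j => (s0*(8/7)^j)^3*L ≤ w^9) ⊆ Finset.range (⌊8*L/15⌋₊+1) := by
      intro j hj
      simp only [Finset.mem_filter, Finset.mem_range] at hj ⊢
      rw [Nat.lt_succ_iff]
      refine Nat.le_floor ?_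
      have h1 := hj.2
      have hl : 1/8 ≤ Real.log (8/7) := by
        have := Real.one_sub_inv_le_log_of_pos (show (0:ℝ) < 8/7 by norm_num)
        norm_num at this ⊢
        linarith
      have h2 : ((8/7:ℝ)^j)^3 ≤ Real.exp (L/5) := by
        rw [← hwe]
        have : 1 ≤ s0^3*L := by nlinarith
        have h3 : 0 < ((8/7:ℝ)^j)^3 := by positivity
        nlinarith
      have h3 := Real.log_le_log (by positivity) h2
      rw [Real.log_exp, Real.log_pow, Real.log_pow] at h3
      have : (j:ℝ)*(1/8) ≤ j * Real.log (8/7) := by gcongr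
      push_cast at h3
      linarith
    have := Finset.card_le_card this
    rw [Finset.card_range] at this
    calc _ ≤ ((⌊8*L/15⌋₊+1 : ℕ):ℝ) := by exact_mod_cast this
      _ ≤ _ := by push_cast; gcongr; exact Nat.floor_le (by positivity)
  have t4 : ∑ j ∈ Finset.range N, 1/(s0*(8/7)^j) ≤ 8/s0 := by
    refine le_trans (le_of_eq (Finset.sum_congr rfl fun j _ => ?_)) (geo_inv s0 s0 hs hs N)
    rw [if_pos]
    have : (1:ℝ) ≤ (8/7)^j := one_le_pow₀ (by norm_num)
    nlinarith
  have t5 : ∑ j ∈ Finset.range N, (if 30 ≤ j then 1/(s0*(8/7)^j) else 0) ≤ 8/(s0*(8/7)^30) := by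
    refine le_trans (Finset.sum_le_sum fun j _ => ?_) (geo_inv s0 (s0*(8/7)^30) hs (by positivity) N)
    by_cases hj : 30 ≤ j
    · rw [if_pos hj, if_pos]
      gcongr
      norm_num
    · rw [if_neg hj]; split_ifs <;> positivity
  have t6 := geo_sq s0 (w^2/2) hs (by positivity) N
  have t7 := geo_inv s0 (w^2/2) hs (by positivity) N
  have t8 := geo_inv s0 (140*w^3/L) hs (by positivity) N
  have u4 : 2833/10000*(w^9*L)*(∑ j ∈ Finset.range N, 1/(s0*(8/7)^j)) ≤ 615/10000*(w^9*L) := by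
    calc _ ≤ 2833/10000*(w^9*L)*(8/(369/10)) := by
          refine mul_le_mul_of_nonneg_left (t4.trans ?_) (by positivity)
          gcongr
      _ ≤ _ := by have : 0 < w^9*L := by positivity
                  linarith
  have u5 : 1047/100*(w^9*L)*(∑ j ∈ Finset.range N, (if 30 ≤ j then 1/(s0*(8/7)^j) else 0)) ≤ 415/10000*(w^9*L) := by
    calc _ ≤ 1047/100*(w^9*L)*(8/((369/10)*(8/7)^30)) := by
          refine mul_le_mul_of_nonneg_left (t5.trans ?_) (by positivity)
          gcongr
      _ = (1047/100*(8/((369/10)*(8/7)^30)))*(w^9*L) := by ring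
      _ ≤ _ := by
        refine mul_le_mul_of_nonneg_right ?_ (by positivity)
        norm_num
  have u6 : 1621/1000*(L/42)*w^5*(∑ j ∈ Finset.range N, (if s0*(8/7)^j ≤ w^2/2 then (s0*(8/7)^j)^2 else 0)) ≤ 412/10000*(w^9*L) := by
    calc _ ≤ 1621/1000*(L/42)*w^5*(64/15*(w^2/2)^2) := by gcongr
      _ = (1621/1000/42*(64/15)/4)*(w^9*L) := by ring
      _ ≤ _ := by
        refine mul_le_mul_of_nonneg_right ?_ (by positivity)
        norm_num
  have u7 : 24636/100000*(L/85)*w^11*(∑ j ∈ Finset.range N, (if w^2/2 ≤ s0*(8/7)^j then 1/(s0*(8/7)^j) else 0)) ≤ 464/10000*(w^9*L) := by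
    calc _ ≤ 24636/100000*(L/85)*w^11*(8/(w^2/2)) := by gcongr
      _ = (24636/100000/85*16)*(w^9*L) := by field_simp; norm_num
      _ ≤ _ := by
        refine mul_le_mul_of_nonneg_right ?_ (by positivity)
        norm_num
  have u8 : 4013/10000*w^12*(∑ j ∈ Finset.range N, (if 140*w^3/L ≤ s0*(8/7)^j then 1/(s0*(8/7)^j) else 0)) ≤ 230/10000*(w^9*L) := by
    calc _ ≤ 4013/10000*w^12*(8/(140*w^3/L)) := by gcongr
      _ = (4013/10000*8/140)*(w^9*L) := by field_simp
      _ ≤ _ := by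
        refine mul_le_mul_of_nonneg_right ?_ (by positivity)
        norm_num
  have t3' : (8*L/15+1)*(628/1000*w^9) = 8/15*(628/1000)*(w^9*L) + 628/1000*w^9 := by ring
  rw [t3'] at t3
  rw [← Finset.mul_sum] at t1
  refine (add_le_add (add_le_add (add_le_add (add_le_add (add_le_add (add_le_add (add_le_add
    t1 t2) t3) u4) u5) u6) u7) u8).trans ?_
  linarith


lemma prime_sq_sum (n : ℕ) (hn : 1 ≤ n) :
    ∑ p ∈ (Finset.range (2*n+1)).filter Nat.Prime, 1/(p:ℝ)^2 ≤ 1/2 - 1/(4*(n:ℝ)) := by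
  rw [Finset.sum_filter]
  induction n, hn using Nat.le_induction with
  | base =>
    simp only [Finset.sum_range_succ, Finset.sum_range_zero]
    norm_num
  | succ n hn ih =>
    rw [show 2*(n+1)+1 = 2*n+1+1+1 by ring, Finset.sum_range_succ, Finset.sum_range_succ]
    have hnp : ¬ Nat.Prime (2*n+1+1) := by
      intro hp
      have := (Nat.prime_dvd_prime_iff_eq Nat.prime_two hp).1 ⟨n+1, by ring⟩
      omega
    rw [if_neg hnp]
    have hn0 : (0:ℝ) < n := by exact_mod_cast hn
    have h1 : (if Nat.Prime (2*n+1) then 1/((2*n+1 : ℕ):ℝ)^2 else 0) ≤ 1/(4*(n:ℝ)) - 1/(4*((n:ℝ)+1)) := by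
      have e : 1/(4*(n:ℝ)) - 1/(4*((n:ℝ)+1)) = 1/(4*n*(n+1)) := by field_simp; ring
      rw [e]
      split_ifs
      · apply one_div_le_one_div_of_le (by positivity)
        push_cast; nlinarith
      · positivity
    push_cast at *
    linarith

lemma prime_sq_sum' (Y : ℕ) :
    ∑ p ∈ (Finset.range (Y+1)).filter Nat.Prime, 1/(p:ℝ)^2 ≤ 1/2 := by
  have h := prime_sq_sum (Y+1) (by omega)
  have h2 : ∑ p ∈ (Finset.range (Y+1)).filter Nat.Prime, 1/(p:ℝ)^2 ≤
      ∑ p ∈ (Finset.range (2*(Y+1)+1)).filter Nat.Prime, 1/(p:ℝ)^2 := by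
    apply Finset.sum_le_sum_of_subset_of_nonneg
    · apply Finset.filter_subset_filter
      apply Finset.range_subset_range.2; omega
    · intros; positivity
  have : (0:ℝ) ≤ 1/(4*((Y+1:ℕ):ℝ)) := by positivity
  linarith

lemma mult_card (a b r : ℕ) (hr : 0 < r) (hab : a ≤ b) :
    (((Finset.Ioc a b).filter (fun n => r ∣ n)).card : ℝ) ≤ ((b:ℝ)-a)/r + 1 := by
  have h := Nat.Ioc_filter_modEq_card a b hr 0
  have e : (Finset.Ioc a b).filter (fun n => n ≡ 0 [MOD r]) = (Finset.Ioc a b).filter (fun n => r ∣ n) := by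
    ext n; simp [Nat.modEq_zero_iff_dvd]
  rw [e] at h
  have hq : (((Finset.Ioc a b).filter (fun n => r ∣ n)).card : ℚ) ≤ ((b:ℚ)-a)/r + 1 := by
    have h' : ((((Finset.Ioc a b).filter (fun n => r ∣ n)).card : ℤ) : ℚ) = _ := congrArg (Int.cast : ℤ → ℚ) h
    rw [Int.cast_natCast] at h'
    rw [h', Int.cast_max]
    have hr' : (0:ℚ) < r := by exact_mod_cast hr
    have hab' : (a:ℚ) ≤ b := by exact_mod_cast hab
    apply max_le
    · push_cast
      have h1 := Int.floor_le (((b:ℚ) - 0)/r)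
      have h2 := Int.lt_floor_add_one (((a:ℚ) - 0)/r)
      rw [sub_div (b:ℚ) (a:ℚ)]
      simp only [sub_zero, Nat.cast_zero] at *
      linarith
    · have : 0 ≤ ((b:ℚ)-a)/r := div_nonneg (by linarith) hr'.le
      simp; linarith
  have h3 : ((((Finset.Ioc a b).filter (fun n => r ∣ n)).card : ℚ) : ℝ) ≤ ((((b:ℚ)-a)/r + 1 : ℚ) : ℝ) :=
    Rat.cast_le.2 hq
  push_cast at h3
  exact h3

lemma big_exp (L : ℝ) (hL : 1800 ≤ L) : 10^6*L^7 ≤ Real.exp (L/15) := by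
  have h := Real.pow_div_factorial_le_exp (L/15) (by linarith) 40
  refine le_trans ?_ h
  have h2 : (120:ℝ)^33 ≤ (L/15)^33 := by gcongr; linarith
  have e : (L/15)^40/(Nat.factorial 40 : ℝ) = (L/15)^7*((L/15)^33/(Nat.factorial 40 : ℝ)) := by ring
  rw [e, show 10^6*L^7 = (L/15)^7*(10^6*15^7) by ring]
  have : (0:ℝ) ≤ L/15 := by linarith
  refine mul_le_mul_of_nonneg_left ?_ (by positivity)
  rw [le_div_iff₀ (by positivity)]
  refine le_trans ?_ h2
  norm_num [Nat.factorial]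

lemma pi_bound (w L : ℝ) (hL : 1800 ≤ L) (hw : 10^6 * L^7 ≤ w^3) (hw1 : 1 ≤ w)
    (hwe : w^9 = Real.exp (L/5)) :
    ((((Finset.range (⌊w^9*L^2/64⌋₊+1)).filter Nat.Prime).card : ℕ) : ℝ) ≤ 219/1000*(w^9*L) := by
  have hL0 : 0 < L := by linarith
  have hw0 : 0 < w := by linarith
  have hX : 0 < w^9 := by positivity
  set y := w^9*L^2/64 with hy
  have h9 : w^3 ≤ w^9 := pow_le_pow_right₀ hw1 (by norm_num)
  have hL7 : 1800 ≤ L^7 := by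
    have := pow_le_pow_right₀ (by linarith : 1 ≤ L) (show 1 ≤ 7 by norm_num)
    linarith
  have hyX : w^9 ≤ y := by
    have : 1 ≤ L^2/64 := by nlinarith
    rw [hy, mul_div_assoc]; nlinarith
  have hX6 : 10^6 ≤ w^9 := by linarith
  have h := Chebyshev.pi_le_log4_mul_div (x := y) (by linarith)
  rw [Nat.primeCounting, Nat.primeCounting', Nat.count_eq_card_filter_range] at h
  refine h.trans ?_
  have hl : L/10 ≤ Real.log √y := by
    rw [Real.log_sqrt (by linarith)]
    have : L/5 ≤ Real.log y := by
      rw [Real.le_log_iff_exp_le (by linarith), ← hwe]; exact hyX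
    linarith
  have hl4 : Real.log 4 ≤ 13863/10000 := by
    rw [show (4:ℝ) = 2^2 by norm_num, Real.log_pow]
    have := Real.log_two_lt_d9
    push_cast; linarith
  have a1 : Real.log 4 * y / Real.log √y ≤ 2167/10000*(w^9*L) := by
    have : 0 ≤ Real.log 4 := Real.log_nonneg (by norm_num)
    have hy0 : 0 < y := by linarith
    calc Real.log 4 * y / Real.log √y ≤ 13863/10000*y/(L/10) := by gcongr
      _ = 13863/10000*10/64*(w^9*L) := by rw [hy]; field_simp
      _ ≤ _ := by
        refine mul_le_mul_of_nonneg_right ?_ (by positivity)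
        norm_num
  have a2 : √y ≤ 1/1000*(w^9*L) := by
    apply Real.sqrt_le_iff.2
    refine ⟨by positivity, ?_⟩
    have : (1/1000*(w^9*L))^2 = 1/10^6*w^9*(w^9*L^2) := by ring
    rw [this, hy]
    have : 0 < w^9*L^2 := by positivity
    nlinarith
  linarith

lemma rt (a : ℝ) (n : ℕ) (ha : 0 ≤ a) (hn : n ≠ 0) : (a^((1:ℝ)/n))^n = a := by
  rw [one_div]; exact Real.rpow_inv_natCast_pow ha hn

lemma jcount (w L : ℝ) (j : ℕ) (hwe : w^9 = Real.exp (L/5)) (h2 : (512/343:ℝ)^j ≤ (w^9)^2) :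
    (j:ℝ) ≤ 16*L/15 := by
  rw [hwe, show (512/343:ℝ) = (8/7)^3 by norm_num] at h2
  have hl : 1/8 ≤ Real.log (8/7) := by
    have := Real.one_sub_inv_le_log_of_pos (show (0:ℝ) < 8/7 by norm_num)
    norm_num at this ⊢
    linarith
  have h3 := Real.log_le_log (by positivity) h2
  rw [Real.log_pow, Real.log_pow, Real.log_pow, Real.log_exp] at h3
  have : (j:ℝ)*(3*(1/8)) ≤ j * (3*Real.log (8/7)) := by gcongr
  push_cast at h3
  linarith

set_option maxHeartbeats 2000000 in
theorem main_aux (w L s0 ρ : ℝ) (hL : 1800 ≤ L) (hw : 10^6 * L^7 ≤ w^3) (hw1 : 1 ≤ w)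
    (hs : 0 < s0) (hwe : w^9 = Real.exp (L/5))
    (hs1 : L^2/64 = s0^3) (hρ : 0 < ρ) (hρ9 : ρ^9 = 249/100*L) :
    ∃ n : ℕ, 0 < n ∧ w^45 < (n : ℝ) ∧ (n : ℝ) ≤ w^45 + 2*w^9*L ∧ Squarefree n := by
  classical
  by_contra hcon
  push Not at hcon
  have hL0 : 0 < L := by linarith
  have hw0 : 0 < w := by linarith
  have hX : 0 < w^9 := by positivity
  have h9 : w^3 ≤ w^9 := pow_le_pow_right₀ hw1 (by norm_num)
  have hL7 : ∀ k, k ≤ 7 → L^k ≤ L^7 := fun k hk => pow_le_pow_right₀ (by linarith : 1 ≤ L) hk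
  have hLX : 10^6*L ≤ w^9 := by have := hL7 1 (by norm_num); linarith
  set x := w^45 with hx
  set h := 2*w^9*L with hh
  have hx0 : 0 < x := by positivity
  have hh0 : 0 < h := by positivity
  have hhx : h ≤ x := by
    rw [hh, hx]
    calc 2*w^9*L = w^9*(2*L) := by ring
      _ ≤ w^9*w^36 := by
        refine mul_le_mul_of_nonneg_left ?_ hX.le
        have : w^9 ≤ w^36 := pow_le_pow_right₀ hw1 (by norm_num)
        linarith
      _ = _ := by ring
  set y := w^9*L^2/64 with hy
  have hy0 : 0 < y := by positivity
  have hyh : h < y^2 := by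
    rw [hh, hy]
    have : (w^9*L^2/64)^2 = w^9*(w^9*L^4/4096) := by ring
    rw [this, show 2*w^9*L = w^9*(2*L) by ring]
    apply mul_lt_mul_of_pos_left _ hX
    have : 1 ≤ L^4 := one_le_pow₀ (by linarith)
    nlinarith
  have hyX : w^9 ≤ y := by
    have : 1 ≤ L^2/64 := by nlinarith
    rw [hy, mul_div_assoc]; nlinarith
  have hy2 : 2 < y := by linarith
  set I := Finset.Ioc ⌊x⌋₊ ⌊x+h⌋₊ with hI
  have hfl : ⌊x⌋₊ ≤ ⌊x+h⌋₊ := Nat.floor_mono (by linarith)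
  have hf1 := Nat.floor_le hx0.le
  have hf2 := Nat.lt_floor_add_one x
  have hf3 := Nat.floor_le (show 0 ≤ x+h by linarith)
  have hf4 := Nat.lt_floor_add_one (x+h)
  have hIc : h - 1 ≤ (I.card : ℝ) := by
    rw [hI, Nat.card_Ioc, Nat.cast_sub hfl]
    linarith
  have hImem : ∀ n ∈ I, x < (n:ℝ) ∧ (n:ℝ) ≤ x+h := by
    intro n hn
    rw [hI, Finset.mem_Ioc] at hn
    exact ⟨(Nat.floor_lt hx0.le).1 hn.1, (Nat.le_floor_iff (by linarith)).1 hn.2⟩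
  set Y := ⌊y⌋₊ with hY
  set m : ℕ → ℤ := fun d => ⌊(x+h)/(d:ℝ)^2⌋ with hm
  set N := ⌊16*L/15⌋₊ + 1 with hN
  set S : ℕ → Finset ℕ := fun j => (Finset.range (⌊x+h⌋₊+1)).filter (fun d =>
    w^9*(s0*(8/7)^j)^3 ≤ (d:ℝ) ∧ (d:ℝ) ≤ 512/343*(w^9*(s0*(8/7)^j)^3) ∧ Odd d ∧
      x < (m d:ℝ)*(d:ℝ)^2) with hS
  have hG : ∀ j < N, Good x h (w^9*(s0*(8/7)^j)^3) (S j) m := by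
    intro j _ d hd
    simp only [hS, Finset.mem_filter] at hd
    obtain ⟨_, h1, h2, h3, h4⟩ := hd
    refine ⟨h1, h2, h3, h4, ?_⟩
    have hd0 : (0:ℝ) < d := lt_of_lt_of_le (by positivity) h1
    have := Int.floor_le ((x+h)/(d:ℝ)^2)
    rwa [le_div_iff₀ (by positivity)] at this
  have hNL : (N:ℝ) ≤ 11/10*L := by
    rw [hN]; push_cast
    have := Nat.floor_le (show 0 ≤ 16*L/15 by positivity)
    linarith
  have hSum := sum_bound w L s0 ρ N S m hL hw hw1 hs hwe hs1 hρ hρ9 hNL hG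
  have hpi := pi_bound w L hL hw hw1 hwe
  rw [← hy, ← hY] at hpi
  have hcover : I ⊆ ((Finset.range (Y+1)).filter Nat.Prime).biUnion
      (fun p => I.filter (fun n => p^2 ∣ n)) ∪
      ((Finset.range N).biUnion S).image (fun d => (m d).toNat*d^2) := by
    intro n hn
    obtain ⟨hn1, hn2⟩ := hImem n hn
    have hn0 : 0 < n := by
      have : (0:ℝ) < n := by linarith
      exact_mod_cast this
    have hsq := hcon n hn0 hn1 hn2
    rw [Nat.squarefree_iff_prime_squarefree] at hsq
    push Not at hsq
    obtain ⟨p, hp, hpn⟩ := hsq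
    rw [← pow_two] at hpn
    rw [Finset.mem_union]
    by_cases hpY : p ≤ Y
    · left
      rw [Finset.mem_biUnion]
      exact ⟨p, by simp [hp]; omega, by simp [hn, hpn]⟩
    · right
      have hpy : y < p := (Nat.floor_lt hy0.le).1 (not_le.1 hpY)
      have hp0 : (0:ℝ) < p := by linarith
      obtain ⟨k, hk⟩ := hpn
      have hk0 : 0 < k := by
        rcases Nat.eq_zero_or_pos k with rfl | hk0
        · simp at hk; omega
        · exact hk0
      have hkR : (n:ℝ) = (k:ℝ)*(p:ℝ)^2 := by rw [hk]; push_cast; ring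
      have hph : h < (p:ℝ)^2 := hyh.trans (by gcongr)
      have hmk : m p = (k:ℤ) := by
        simp only [hm]
        rw [Int.floor_eq_iff]
        constructor
        · rw [le_div_iff₀ (by positivity)]; push_cast; linarith
        · rw [div_lt_iff₀ (by positivity)]; push_cast; linarith
      have hpn' : p ≤ n := by
        rw [hk]
        calc p = p*1*1 := by ring
          _ ≤ p*p*k := by gcongr; exacts [hp.one_le, hk0]
          _ = _ := by ring
      have hodd : Odd p := by
        apply hp.odd_of_ne_two
        rintro rfl
        norm_num at hpy
        linarith
      rw [Finset.mem_image]
      refine ⟨p, ?_, ?_⟩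
      · rw [Finset.mem_biUnion]
        obtain ⟨j, hj1, hj2⟩ := exists_nat_pow_near (x := (p:ℝ)/y) (y := (512/343:ℝ))
          (by rw [le_div_iff₀ hy0]; linarith) (by norm_num)
        rw [le_div_iff₀ hy0] at hj1
        rw [div_lt_iff₀ hy0] at hj2
        have eT : w^9*(s0*(8/7)^j)^3 = (512/343)^j*y := by
          rw [hy, show w^9*L^2/64 = w^9*(L^2/64) by ring, hs1, mul_pow, ← pow_mul, mul_comm j 3, pow_mul]
          norm_num
          ring
        have hp27 : (p:ℝ) ≤ w^27 := by
          refine le_of_pow_le_pow_left₀ (n := 2) (by norm_num) (by positivity) ?_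
          have h1k : (1:ℝ) ≤ k := by exact_mod_cast hk0
          have h2 : (p:ℝ)^2 ≤ x + h := by nlinarith
          have h3 : (w^27)^2 = x*w^9 := by rw [hx]; ring
          rw [h3]
          nlinarith
        refine ⟨j, ?_, ?_⟩
        · rw [Finset.mem_range, hN, Nat.lt_succ_iff]
          refine Nat.le_floor ?_
          apply jcount w L j hwe
          have : (512/343:ℝ)^j*w^9 ≤ (w^9)^2*w^9 := by
            calc (512/343:ℝ)^j*w^9 ≤ (512/343:ℝ)^j*y := by gcongr
              _ ≤ w^27 := by linarith
              _ = _ := by ring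
          exact le_of_mul_le_mul_right this hX
        · simp only [hS, Finset.mem_filter]
          refine ⟨?_, ?_, ?_, hodd, ?_⟩
          · rw [Finset.mem_range]
            rw [hI, Finset.mem_Ioc] at hn
            omega
          · rw [eT]; exact hj1
          · rw [eT]
            rw [pow_succ] at hj2
            linarith
          · rw [hmk]; push_cast; linarith
      · rw [hmk, hk]; simp; ring
  have hc1 := (Finset.card_le_card hcover).trans (Finset.card_union_le _ _)
  have hc2 : (((Finset.range (Y+1)).filter Nat.Prime).biUnion
      (fun p => I.filter (fun n => p^2 ∣ n))).card ≤ _ := Finset.card_biUnion_le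
  have hc3 : (((Finset.range N).biUnion S).image (fun d => (m d).toNat*d^2)).card ≤ _ :=
    Finset.card_image_le.trans Finset.card_biUnion_le
  have hc2' : ((∑ p ∈ (Finset.range (Y+1)).filter Nat.Prime, (I.filter (fun n => p^2 ∣ n)).card : ℕ):ℝ)
      ≤ (h+1)*(1/2) + ((Finset.range (Y+1)).filter Nat.Prime).card := by
    push_cast
    calc _ ≤ ∑ p ∈ (Finset.range (Y+1)).filter Nat.Prime, ((h+1)*(1/(p:ℝ)^2) + 1) := by
          refine Finset.sum_le_sum fun p hp => ?_
          have hp' : p.Prime := (Finset.mem_filter.1 hp).2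
          have hp0 : (0:ℝ) < p := by exact_mod_cast hp'.pos
          refine (mult_card _ _ (p^2) (pow_pos hp'.pos 2) hfl).trans ?_
          push_cast
          rw [mul_one_div]
          gcongr
          linarith
      _ = (h+1)*(∑ p ∈ (Finset.range (Y+1)).filter Nat.Prime, 1/(p:ℝ)^2) + ((Finset.range (Y+1)).filter Nat.Prime).card := by
          rw [Finset.sum_add_distrib, Finset.mul_sum]; simp
      _ ≤ _ := by gcongr; exact prime_sq_sum' Y
  have hfin : (I.card:ℝ) ≤ ((∑ p ∈ (Finset.range (Y+1)).filter Nat.Prime, (I.filter (fun n => p^2 ∣ n)).card : ℕ):ℝ)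
      + ((∑ j ∈ Finset.range N, (S j).card : ℕ):ℝ) := by
    exact_mod_cast hc1.trans (add_le_add hc2 hc3)
  push_cast at hfin hc2'
  have : 1800 ≤ w^9*L := by nlinarith
  have hh' : h = 2*(w^9*L) := by rw [hh]; ring
  linarith

/-- For every real `x ≥ e^{1800}`, the interval `(x, x + 2·x^{1/5}·log x]` contains a
squarefree integer. -/
theorem squarefree_in_interval_larger (x : ℝ) (hx : Real.exp 1800 ≤ x) :
    ∃ n : ℕ, 0 < n ∧ x < (n : ℝ) ∧ (n : ℝ) ≤ x + 2 * x ^ ((1 : ℝ) / 5) * Real.log x ∧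
      Squarefree n := by
  have hx0 : 0 < x := lt_of_lt_of_le (Real.exp_pos _) hx
  have hL : 1800 ≤ Real.log x := (Real.le_log_iff_exp_le hx0).2 hx
  set L := Real.log x with hLd
  have hL0 : 0 < L := by linarith
  have e3 : Real.exp (L/45)^3 = Real.exp (L/15) := by
    rw [← Real.exp_nat_mul]; congr 1; push_cast; ring
  have e9 : Real.exp (L/45)^9 = Real.exp (L/5) := by
    rw [← Real.exp_nat_mul]; congr 1; push_cast; ring
  have e45 : Real.exp (L/45)^45 = x := by
    rw [← Real.exp_nat_mul, show ((45:ℕ):ℝ)*(L/45) = L by push_cast; ring, hLd, Real.exp_log hx0]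
  have hrt : x^((1:ℝ)/5) = Real.exp (L/45)^9 := by
    rw [e9, Real.rpow_def_of_pos hx0, ← hLd]; congr 1; ring
  have h := main_aux (Real.exp (L/45)) L ((L^2/64)^((1:ℝ)/3)) ((249/100*L)^((1:ℝ)/9)) hL
    (by rw [e3]; exact big_exp L hL) (Real.one_le_exp (by positivity)) (by positivity) e9
    (rt _ 3 (by positivity) (by norm_num)).symm (by positivity)
    (rt _ 9 (by positivity) (by norm_num))
  rw [e45] at h
  rw [hrt]
  exact h
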